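/- Fix d = 3 and let ν, η > 0, M > 0 and a smooth zero-average divergence-free u₀ : 𝕋³ → ℝ³ be given. There exist a smooth divergence-free zero-average field b₀ : 𝕋³ → ℝ³ with ‖b₀‖_{L²} = M, a time T₀ > 0, and a smooth solution (u, b, P) of the MHD system on 𝕋³ on the time interval [0, T₀) with initial datum (u₀, b₀), such that for every t ∈ (0, T₀) there is no homeomorphism of 𝕋³ onto itself mapping the family of magnetic lines of b(0,·) onto the family of magnetic lines of b(t,·); that is, the topology of the magnetic lines changes instantaneously. -/

import Mathlib

open MeasureTheory Real Set

noncomputable section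

/-- Partial derivative of a scalar function on `ℝ^d` in the `i`-th coordinate direction. -/
def pd {d : ℕ} (i : Fin d) (f : (Fin d → ℝ) → ℝ) : (Fin d → ℝ) → ℝ :=
  fun x => fderiv ℝ f x (Pi.single i 1)

/-- Iterated partial derivative along a list of directions. -/
def pdList {d : ℕ} : List (Fin d) → ((Fin d → ℝ) → ℝ) → ((Fin d → ℝ) → ℝ)
  | [], f => f
  | i :: l, f => pd i (pdList l f)

/-- The list of directions associated to a multi-index `α`
(the direction `i` repeated `α i` times). -/
def mIdxList {d : ℕ} (α : Fin d → ℕ) : List (Fin d) :=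
  ((List.finRange d).map fun i => List.replicate (α i) i).flatten

/-- The partial derivative `∂^α f` for a multi-index `α`. -/
def pdM {d : ℕ} (α : Fin d → ℕ) (f : (Fin d → ℝ) → ℝ) : (Fin d → ℝ) → ℝ :=
  pdList (mIdxList α) f

/-- `|∇^m w|²(x) = ∑_{|α| = m} |∂^α w(x)|²` for a vector field `w : ℝ^d → ℝ^k`. -/
def gradSq {d k : ℕ} (m : ℕ) (w : (Fin d → ℝ) → Fin k → ℝ) (x : Fin d → ℝ) : ℝ :=
  ∑ α ∈ Finset.Nat.antidiagonalTuple d m, ∑ i, pdM α (fun y => w y i) x ^ 2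

/-- The fundamental domain `[0,L]^d` of the torus `ℝ^d/(Lℤ)^d`. -/
def box (d : ℕ) (L : ℝ) : Set (Fin d → ℝ) := Set.Icc 0 fun _ => L

/-- Square of the Sobolev `H^r` norm on the torus of period `L`. -/
def HnormSq {d k : ℕ} (L : ℝ) (r : ℕ) (w : (Fin d → ℝ) → Fin k → ℝ) : ℝ :=
  ∑ m ∈ Finset.range (r + 1), ∫ x in box d L, gradSq m w x

/-- The Sobolev `H^r` norm on the torus of period `L`. -/
def Hnorm {d k : ℕ} (L : ℝ) (r : ℕ) (w : (Fin d → ℝ) → Fin k → ℝ) : ℝ :=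
  Real.sqrt (HnormSq L r w)

/-- The `L²` norm on the torus of period `L`. -/
def L2norm {d k : ℕ} (L : ℝ) (w : (Fin d → ℝ) → Fin k → ℝ) : ℝ :=
  Real.sqrt (∫ x in box d L, ∑ i, w x i ^ 2)

/-- The `L^∞` norm of `∇^m w`. -/
def LinfGrad {d k : ℕ} (m : ℕ) (w : (Fin d → ℝ) → Fin k → ℝ) : ℝ :=
  ⨆ x : Fin d → ℝ, Real.sqrt (gradSq m w x)

/-- The `L^∞` norm of `w`. -/
def Linf {d k : ℕ} (w : (Fin d → ℝ) → Fin k → ℝ) : ℝ := LinfGrad 0 w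

/-- `L`-periodicity in each coordinate direction. -/
def Prdc {d : ℕ} {E : Type*} (L : ℝ) (w : (Fin d → ℝ) → E) : Prop :=
  ∀ (x : Fin d → ℝ) (i : Fin d), w (x + Pi.single i L) = w x

/-- Zero average on the torus. -/
def ZeroAvg {d k : ℕ} (L : ℝ) (w : (Fin d → ℝ) → Fin k → ℝ) : Prop :=
  ∀ i, (∫ x in box d L, w x i) = 0

/-- Divergence of a vector field on `ℝ^d`. -/
def divg {d : ℕ} (w : (Fin d → ℝ) → Fin d → ℝ) (x : Fin d → ℝ) : ℝ :=
  ∑ i, pd i (fun y => w y i) x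

/-- A smooth solution of the MHD system with viscosity `ν` and resistivity `η` on the torus
`ℝ^d/(Lℤ)^d`, on the time interval `J` (the equations are imposed at positive times of `J`). -/
structure IsMHD (d : ℕ) (L ν η : ℝ) (J : Set ℝ)
    (u b : ℝ → (Fin d → ℝ) → Fin d → ℝ) (P : ℝ → (Fin d → ℝ) → ℝ) : Prop where
  smooth_u : ContDiffOn ℝ (⊤ : ℕ∞) (fun p : ℝ × (Fin d → ℝ) => u p.1 p.2) (J ×ˢ Set.univ)
  smooth_b : ContDiffOn ℝ (⊤ : ℕ∞) (fun p : ℝ × (Fin d → ℝ) => b p.1 p.2) (J ×ˢ Set.univ)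
  smooth_P : ContDiffOn ℝ (⊤ : ℕ∞) (fun p : ℝ × (Fin d → ℝ) => P p.1 p.2) (J ×ˢ Set.univ)
  periodic_u : ∀ t ∈ J, Prdc L (u t)
  periodic_b : ∀ t ∈ J, Prdc L (b t)
  periodic_P : ∀ t ∈ J, Prdc L (P t)
  div_u : ∀ t ∈ J, ∀ x, divg (u t) x = 0
  div_b : ∀ t ∈ J, ∀ x, divg (b t) x = 0
  momentum : ∀ t ∈ J, 0 < t → ∀ x i,
    deriv (fun s => u s x i) t + (∑ j, u t x j * pd j (fun y => u t y i) x) + pd i (P t) x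
      = ν * (∑ j, pd j (pd j fun y => u t y i) x) + ∑ j, b t x j * pd j (fun y => b t y i) x
  induction_eq : ∀ t ∈ J, 0 < t → ∀ x i,
    deriv (fun s => b s x i) t + (∑ j, u t x j * pd j (fun y => b t y i) x)
      = (∑ j, b t x j * pd j (fun y => u t y i) x)
        + η * (∑ j, pd j (pd j fun y => b t y i) x)

/-- Projection from `ℝ^d` onto the torus `ℝ^d/(Lℤ)^d`. -/
def torusProj (d : ℕ) (L : ℝ) (x : Fin d → ℝ) : Fin d → AddCircle L :=
  fun i => (x i : AddCircle L)

/-- A magnetic line of the field `b`: the image on the torus of a maximal (hence, since the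
relevant fields are smooth and periodic, globally defined) integral curve of `b`. -/
def IsMagLine (d : ℕ) (L : ℝ) (b : (Fin d → ℝ) → Fin d → ℝ)
    (s : Set (Fin d → AddCircle L)) : Prop :=
  ∃ γ : ℝ → Fin d → ℝ, (∀ τ : ℝ, HasDerivAt γ (b (γ τ)) τ) ∧
    s = torusProj d L '' Set.range γ

/-- The families of magnetic lines of `b₁` and `b₂` are topologically equivalent: some
self-homeomorphism of the torus maps the family of magnetic lines of `b₁` bijectively onto the
family of magnetic lines of `b₂`. -/
def MagLinesEquiv (d : ℕ) (L : ℝ) (b₁ b₂ : (Fin d → ℝ) → Fin d → ℝ) : Prop :=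
  ∃ φ : (Fin d → AddCircle L) ≃ₜ (Fin d → AddCircle L),
    ∀ s : Set (Fin d → AddCircle L), IsMagLine d L b₁ s ↔ IsMagLine d L b₂ (φ '' s)

open Filter Topology

/-- A small bounded bilinear perturbation of the identity has a fixed point
in every closed set that is stable under the iteration. -/
theorem exists_eq_add_bilin {X : Type*} [NormedAddCommGroup X] [CompleteSpace X]
    (B : X → X → X) (K : ℝ) (hK : 0 ≤ K) (hB : ∀ x y, ‖B x y‖ ≤ K * ‖x‖ * ‖y‖)
    (hsub : ∀ x y, B x x - B y y = B (x - y) x + B y (x - y))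
    (a : X) (ha : 8 * K * ‖a‖ ≤ 1) (S : Set X) (hS : IsClosed S) (haS : a ∈ S)
    (hmaps : ∀ x ∈ S, a + B x x ∈ S) :
    ∃ x ∈ S, x = a + B x x := by
  set s : Set X := S ∩ Metric.closedBall 0 (2 * ‖a‖)
  have hs : IsComplete s := (hS.inter Metric.isClosed_closedBall).isComplete
  have hKa : 0 ≤ K * ‖a‖ := by positivity
  have hms : MapsTo (fun x => a + B x x) s s := by
    rintro x ⟨hxS, hx⟩
    refine ⟨hmaps x hxS, ?_⟩
    rw [mem_closedBall_zero_iff] at hx ⊢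
    have h1 : K * ‖x‖ * ‖x‖ ≤ K * (2 * ‖a‖) * (2 * ‖a‖) := by gcongr
    have h2 := norm_add_le a (B x x)
    have h3 := hB x x
    nlinarith [norm_nonneg a]
  have hc : ContractingWith (1 / 2) (hms.restrict _ s s) := by
    refine ⟨by norm_num, LipschitzWith.of_dist_le_mul ?_⟩
    rintro ⟨x, hxS, hx⟩ ⟨y, hyS, hy⟩
    rw [mem_closedBall_zero_iff] at hx hy
    rw [Subtype.dist_eq, Subtype.dist_eq, dist_eq_norm, dist_eq_norm]
    simp only [MapsTo.val_restrict_apply]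
    rw [add_sub_add_left_eq_sub, hsub]
    have h1 := norm_add_le (B (x - y) x) (B y (x - y))
    have h2 : K * ‖x - y‖ * ‖x‖ ≤ K * ‖x - y‖ * (2 * ‖a‖) := by gcongr
    have h3 : K * ‖y‖ * ‖x - y‖ ≤ K * (2 * ‖a‖) * ‖x - y‖ := by gcongr
    have h4 := hB (x - y) x
    have h5 := hB y (x - y)
    have h6 : (((1 / 2 : NNReal)) : ℝ) = 1 / 2 := by norm_num
    rw [h6]
    nlinarith [norm_nonneg (x - y)]
  have has : a ∈ s := ⟨haS, by
    rw [mem_closedBall_zero_iff]; linarith [norm_nonneg a]⟩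
  obtain ⟨x, hx, hfx, -⟩ := hc.exists_fixedPoint' hs hms has (edist_ne_top _ _)
  exact ⟨x, hx.1, hfx.symm⟩

/-- Termwise differentiation of a series on a convex set. -/
theorem hasFDerivWithinAt_tsum_of_convex {ι E F : Type*} [NormedAddCommGroup E] [NormedSpace ℝ E]
    [NormedAddCommGroup F] [NormedSpace ℝ F] [CompleteSpace F] {s : Set E} (hs : Convex ℝ s)
    {f : ι → E → F} {f' : ι → E → E →L[ℝ] F} {v : ι → ℝ} (hv : Summable v)
    (hf : ∀ i, ∀ x ∈ s, HasFDerivWithinAt (f i) (f' i x) s x)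
    (hf' : ∀ i, ∀ x ∈ s, ‖f' i x‖ ≤ v i) (hsum : ∀ x ∈ s, Summable fun i => f i x)
    {x : E} (hx : x ∈ s) {L : E →L[ℝ] F} (hL : HasSum (fun i => f' i x) L) :
    HasFDerivWithinAt (fun y => ∑' i, f i y) L s x := by
  have hmv : ∀ i, ∀ y ∈ s, ‖f i y - f i x‖ ≤ v i * ‖y - x‖ := fun i y hy =>
    hs.norm_image_sub_le_of_norm_hasFDerivWithin_le (hf i) (hf' i) hx hy
  rw [hasFDerivWithinAt_iff_tendsto]
  have key : Tendsto (fun y => ∑' i, ‖y - x‖⁻¹ • (f i y - f i x - f' i x (y - x))) (𝓝[s] x)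
      (𝓝 (∑' _ : ι, (0 : F))) := by
    refine tendsto_tsum_of_dominated_convergence (bound := fun i => 2 * v i) (hv.mul_left 2) ?_ ?_
    · intro i
      have h := hasFDerivWithinAt_iff_tendsto.1 (hf i x hx)
      rw [tendsto_zero_iff_norm_tendsto_zero]
      refine h.congr fun y => ?_
      rw [norm_smul, norm_inv, norm_norm]
    · filter_upwards [self_mem_nhdsWithin] with y hy i
      rw [norm_smul, norm_inv, norm_norm]
      have h1 := hmv i y hy
      have h2 : ‖f' i x (y - x)‖ ≤ v i * ‖y - x‖ :=
        ((f' i x).le_opNorm _).trans (by gcongr; exact hf' i x hx)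
      have h3 : ‖f i y - f i x - f' i x (y - x)‖ ≤ 2 * v i * ‖y - x‖ :=
        (norm_sub_le _ _).trans (by linarith)
      have hv0 : 0 ≤ v i := (norm_nonneg _).trans (hf' i x hx)
      rcases (norm_nonneg (y - x)).eq_or_lt' with h0 | h0
      · rw [h0]; simp [hv0]
      · rw [inv_mul_le_iff₀ h0]; linarith
  rw [tsum_zero] at key
  rw [tendsto_zero_iff_norm_tendsto_zero] at key
  refine key.congr' ?_
  filter_upwards [self_mem_nhdsWithin] with y hy
  have hLy : HasSum (fun i => f' i x (y - x)) (L (y - x)) :=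
    hL.mapL (ContinuousLinearMap.apply ℝ F (y - x))
  have h := (((hsum y hy).hasSum.sub (hsum x hx).hasSum).sub hLy).const_smul (‖y - x‖⁻¹)
  rw [h.tsum_eq, norm_smul, norm_inv, norm_norm]

section Convolution

variable {G : Type*} [AddCommGroup G]

/-- The bijection `(k, j) ↦ (j, k - j)`. -/
def subShear (G : Type*) [AddCommGroup G] : G × G ≃ G × G where
  toFun p := (p.2, p.1 - p.2)
  invFun q := (q.1 + q.2, q.1)
  left_inv p := by simp
  right_inv q := by simp

theorem summable_mul_shear {R : Type*} [NormedCommRing R] [CompleteSpace R] {f g : G → R}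
    (hf : Summable fun k => ‖f k‖) (hg : Summable fun k => ‖g k‖) :
    Summable fun p : G × G => f p.2 * g (p.1 - p.2) :=
  ((subShear G).summable_iff (f := fun q : G × G => f q.1 * g q.2)).2
    (summable_mul_of_summable_norm hf hg)

theorem hasSum_conv {R : Type*} [NormedCommRing R] [CompleteSpace R] {f g : G → R}
    (hf : Summable fun k => ‖f k‖) (hg : Summable fun k => ‖g k‖) :
    HasSum (fun k => ∑' j, f j * g (k - j)) ((∑' k, f k) * ∑' k, g k) := by
  have h := summable_mul_shear hf hg
  have h2 := h.hasSum.prod_fiberwise fun k => (h.prod_factor k).hasSum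
  rwa [tsum_mul_tsum_of_summable_norm hf hg, ← (subShear G).tsum_eq]

theorem summable_conv_term {R : Type*} [NormedCommRing R] [CompleteSpace R] {f g : G → R}
    (hf : Summable fun k => ‖f k‖) (hg : Summable fun k => ‖g k‖) (k : G) :
    Summable fun j => f j * g (k - j) :=
  (summable_mul_shear hf hg).prod_factor k

end Convolution

/-- Nonnegative families on the lattice that decay faster than every power. -/
def RapidDecay {d : ℕ} (M : (Fin d → ℤ) → ℝ) : Prop :=
  (∀ k, 0 ≤ M k) ∧ ∀ n : ℕ, Summable fun k => (1 + ‖k‖) ^ n * M k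

namespace RapidDecay

variable {d : ℕ} {M N : (Fin d → ℤ) → ℝ}

theorem summable (hM : RapidDecay M) : Summable M := by simpa using hM.2 0

theorem mono (hM : RapidDecay M) (h0 : ∀ k, 0 ≤ N k) (h : ∀ k, N k ≤ M k) : RapidDecay N :=
  ⟨h0, fun n => (hM.2 n).of_nonneg_of_le (fun k => mul_nonneg (by positivity) (h0 k))
    fun k => by gcongr; exact h k⟩

theorem add (hM : RapidDecay M) (hN : RapidDecay N) : RapidDecay fun k => M k + N k :=
  ⟨fun k => add_nonneg (hM.1 k) (hN.1 k), fun n => by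
    simpa only [mul_add] using (hM.2 n).add (hN.2 n)⟩

theorem poly_mul (hM : RapidDecay M) {C : ℝ} (hC : 0 ≤ C) (n : ℕ) :
    RapidDecay fun k => C * (1 + ‖k‖) ^ n * M k :=
  ⟨fun k => mul_nonneg (by positivity) (hM.1 k), fun m =>
    ((hM.2 (m + n)).mul_left C).congr fun k => by rw [pow_add]; ring⟩

theorem sum {ι : Type*} (s : Finset ι) {M : ι → (Fin d → ℤ) → ℝ} (hM : ∀ i ∈ s, RapidDecay (M i)) :
    RapidDecay fun k => ∑ i ∈ s, M i k :=
  ⟨fun k => Finset.sum_nonneg fun i hi => (hM i hi).1 k, fun n => by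
    simpa only [Finset.mul_sum] using summable_sum fun i hi => (hM i hi).2 n⟩

theorem conv (hM : RapidDecay M) (hN : RapidDecay N) :
    RapidDecay fun k => ∑' j, M j * N (k - j) := by
  refine ⟨fun k => tsum_nonneg fun j => mul_nonneg (hM.1 _) (hN.1 _), fun n => ?_⟩
  have h1 := hM.2 n
  have h2 := hN.2 n
  have h := (hasSum_conv h1.norm h2.norm).summable
  refine h.of_nonneg_of_le (fun k => mul_nonneg (by positivity)
    (tsum_nonneg fun j => mul_nonneg (hM.1 _) (hN.1 _))) fun k => ?_
  rw [← tsum_mul_left]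
  refine Summable.tsum_le_tsum (fun j => ?_)
    ((summable_conv_term hM.summable.norm hN.summable.norm k).mul_left _)
    (summable_conv_term h1.norm h2.norm k)
  have hk : 1 + ‖k‖ ≤ (1 + ‖j‖) * (1 + ‖k - j‖) := by
    have : ‖k‖ ≤ ‖j‖ + ‖k - j‖ := by simpa using norm_add_le j (k - j)
    nlinarith [norm_nonneg j, norm_nonneg (k - j)]
  calc (1 + ‖k‖) ^ n * (M j * N (k - j))
      ≤ ((1 + ‖j‖) * (1 + ‖k - j‖)) ^ n * (M j * N (k - j)) := by
        have := mul_nonneg (hM.1 j) (hN.1 (k - j)); gcongr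
    _ = _ := by rw [mul_pow]; ring

theorem summable_prod_inv (d : ℕ) :
    Summable fun k : Fin d → ℤ => ∏ j, (1 + (k j : ℝ) ^ 2)⁻¹ := by
  have h1 : Summable fun n : ℤ => (1 + (n : ℝ) ^ 2)⁻¹ := by
    have h0 : Summable fun n : ℤ => 1 / (n : ℝ) ^ 2 :=
      Real.summable_one_div_int_pow.2 one_lt_two
    refine (summable_of_hasFiniteSupport (f := fun n : ℤ => if n = 0 then (1 : ℝ) else 0) ?_).add h0
      |>.of_nonneg_of_le (fun n => by positivity) fun n => ?_
    · exact (finite_singleton (0 : ℤ)).subset fun n hn => by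
        by_contra h; simp_all
    · by_cases hn : n = 0
      · simp [hn]
      · simp only [hn, if_false, zero_add, one_div]
        have : (0 : ℝ) < (n : ℝ) ^ 2 := by positivity
        gcongr; linarith
  induction d with
  | zero => exact .of_finite
  | succ d ih =>
    rw [← (Fin.consEquiv fun _ => ℤ).summable_iff]
    refine (h1.mul_of_nonneg ih (fun n => by positivity) fun k => ?_).congr fun p => ?_
    · exact Finset.prod_nonneg fun j _ => by positivity
    · simp [Fin.prod_univ_succ, Fin.consEquiv, mul_comm]

theorem of_bounded (h0 : ∀ k, 0 ≤ M k) (h : ∀ n : ℕ, ∃ C, ∀ k, (1 + ‖k‖) ^ n * M k ≤ C) :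
    RapidDecay M := by
  refine ⟨h0, fun n => ?_⟩
  obtain ⟨C, hC⟩ := h (n + 2 * d)
  refine ((summable_prod_inv d).mul_left C).of_nonneg_of_le
    (fun k => mul_nonneg (by positivity) (h0 k)) fun k => ?_
  have hp : ∏ j, (1 + (k j : ℝ) ^ 2) ≤ (1 + ‖k‖) ^ (2 * d) := by
    have : ∏ j : Fin d, (1 + (k j : ℝ) ^ 2) ≤ ∏ _j : Fin d, (1 + ‖k‖) ^ 2 := by
      refine Finset.prod_le_prod (fun j _ => by positivity) fun j _ => ?_
      have h1 : |(k j : ℝ)| ≤ ‖k‖ := by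
        have := norm_le_pi_norm k j
        rwa [Int.norm_eq_abs] at this
      have := abs_nonneg (k j : ℝ)
      nlinarith [sq_abs (k j : ℝ)]
    simpa [← pow_mul] using this
  have hpos : 0 < ∏ j, (1 + (k j : ℝ) ^ 2) := Finset.prod_pos fun j _ => by positivity
  rw [Finset.prod_inv_distrib, ← div_eq_mul_inv, le_div_iff₀ hpos]
  refine le_trans ?_ (hC k)
  rw [pow_add, mul_assoc, mul_assoc, mul_comm (M k)]
  have := h0 k
  gcongr

/-- A rapidly decaying family stays summable against some submultiplicative weight that
dominates every power. -/
theorem exists_weight (hM : RapidDecay M) :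
    ∃ w : (Fin d → ℤ) → ℝ, (∀ k, 1 ≤ w k) ∧ (∀ k, w (-k) = w k) ∧
      (∀ k l, w (k + l) ≤ w k * w l) ∧
      (∀ n : ℕ, ∃ C, 0 ≤ C ∧ ∀ k, (1 + ‖k‖) ^ n ≤ C * w k) ∧ Summable fun k => w k * M k := by
  set A : ℕ → ℝ := fun n => ∑' k, (1 + ‖k‖) ^ n * M k
  have hA : ∀ n, 0 ≤ A n := fun n => tsum_nonneg fun k => mul_nonneg (by positivity) (hM.1 k)
  set D : ℕ → ℝ := fun n => 1 + ∑ i ∈ Finset.range (n + 1), A i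
  have hD1 : ∀ n, 1 ≤ D n := fun n => by
    have := Finset.sum_nonneg fun i (_ : i ∈ Finset.range (n + 1)) => hA i
    simp only [D]; linarith
  have hDA : ∀ n, A n ≤ D n := fun n => by
    have := Finset.single_le_sum (fun i _ => hA i) (Finset.self_mem_range_succ n)
    simp only [D]; linarith
  have hDm : Monotone D := fun a b hab => by
    simp only [D]
    gcongr 1 + ?_
    exact Finset.sum_le_sum_of_subset_of_nonneg
      (Finset.range_mono (by omega)) fun i _ _ => hA i
  set c : ℕ → ℝ := fun n => ∏ i ∈ Finset.range n, (D (i + 1))⁻¹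
  have hDinv : ∀ n, (D n)⁻¹ ≤ 1 := fun n => inv_le_one_of_one_le₀ (hD1 n)
  have hDpos : ∀ n, 0 < D n := fun n => one_pos.trans_le (hD1 n)
  have hDinv0 : ∀ n, 0 < (D n)⁻¹ := fun n => inv_pos.2 (hDpos n)
  have hc0 : ∀ n, 0 < c n := fun n => Finset.prod_pos fun i _ => hDinv0 _
  have hc1 : ∀ n, c n ≤ 1 := fun n =>
    Finset.prod_le_one (fun i _ => (hDinv0 _).le) fun i _ => hDinv _
  have hcA : ∀ n, c n * A n ≤ 1 + A 0 := by
    intro n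
    cases n with
    | zero => simp [c]
    | succ n =>
      have h1 : c (n + 1) ≤ (D (n + 1))⁻¹ := by
        simp only [c]
        rw [Finset.prod_range_succ]
        exact mul_le_of_le_one_left (hDinv0 _).le (hc1 n)
      have h2 : c (n + 1) * A (n + 1) ≤ (D (n + 1))⁻¹ * D (n + 1) :=
        mul_le_mul h1 (hDA _) (hA _) (hDinv0 _).le
      rw [inv_mul_cancel₀ (hDpos _).ne'] at h2
      linarith [hA 0]
  have hcadd : ∀ i j, c (i + j) ≤ c i * c j := by
    intro i j
    simp only [c]
    rw [Finset.prod_range_add]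
    refine mul_le_mul_of_nonneg_left ?_ (hc0 i).le
    refine Finset.prod_le_prod (fun x _ => (hDinv0 _).le) fun x _ => ?_
    exact inv_anti₀ (hDpos _) (hDm (by omega))
  set s : (Fin d → ℤ) → ℝ := fun k => 1 + ‖k‖
  have hs : ∀ k, 0 ≤ s k := fun k => by positivity
  have hsum : ∀ x : ℝ, 0 ≤ x → Summable fun n : ℕ => c n * (x ^ n / n.factorial) := fun x hx =>
    (Real.summable_pow_div_factorial x).of_nonneg_of_le
      (fun n => mul_nonneg (hc0 n).le (by positivity))
      fun n => mul_le_of_le_one_left (by positivity) (hc1 n)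
  have hnn : ∀ (x : ℝ), 0 ≤ x → ∀ n : ℕ, 0 ≤ c n * (x ^ n / n.factorial) := fun x hx n =>
    mul_nonneg (hc0 n).le (by positivity)
  refine ⟨fun k => ∑' n : ℕ, c n * (s k ^ n / n.factorial), fun k => ?_, fun k => ?_,
    fun k l => ?_, fun n => ?_, ?_⟩
  · simpa [c] using (hsum _ (hs k)).le_tsum 0 fun j _ => hnn _ (hs k) j
  · simp [s]
  · have hskl : s (k + l) ≤ s k + s l := by
      simp only [s]; linarith [norm_add_le k l]
    rw [tsum_mul_tsum_eq_tsum_sum_antidiagonal_of_summable_norm (hsum _ (hs k)).norm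
      (hsum _ (hs l)).norm]
    refine Summable.tsum_le_tsum (fun n => ?_) (hsum _ (hs _))
      (summable_norm_sum_mul_antidiagonal_of_summable_norm (hsum _ (hs k)).norm
        (hsum _ (hs l)).norm).of_norm
    have hbin : (s k + s l) ^ n / n.factorial =
        ∑ p ∈ Finset.HasAntidiagonal.antidiagonal n, (s k ^ p.1 / p.1.factorial) * (s l ^ p.2 / p.2.factorial) := by
      rw [(Commute.all (s k) (s l)).add_pow', Finset.sum_div]
      refine Finset.sum_congr rfl fun p hp => ?_
      have hp' := Finset.HasAntidiagonal.mem_antidiagonal.1 hp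
      have hch := Nat.choose_mul_factorial_mul_factorial (show p.1 ≤ n by omega)
      rw [show n - p.1 = p.2 by omega] at hch
      have hch' : ((n.choose p.1 : ℕ) : ℝ) * p.1.factorial * p.2.factorial = n.factorial := by
        exact_mod_cast hch
      rw [nsmul_eq_mul, ← hch']
      have e1 : (p.1.factorial : ℝ) ≠ 0 := by positivity
      have e2 : (p.2.factorial : ℝ) ≠ 0 := by positivity
      have e3 : ((n.choose p.1 : ℕ) : ℝ) ≠ 0 := by
        have := Nat.choose_pos (show p.1 ≤ n by omega)
        positivity
      field_simp
    calc c n * (s (k + l) ^ n / n.factorial) ≤ c n * ((s k + s l) ^ n / n.factorial) := by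
          have := (hc0 n).le; have := hs (k + l); gcongr
      _ = ∑ p ∈ Finset.HasAntidiagonal.antidiagonal n,
          c n * ((s k ^ p.1 / p.1.factorial) * (s l ^ p.2 / p.2.factorial)) := by
          rw [hbin, Finset.mul_sum]
      _ ≤ _ := by
          refine Finset.sum_le_sum fun p hp => ?_
          rw [← Finset.HasAntidiagonal.mem_antidiagonal.1 hp]
          calc _ ≤ (c p.1 * c p.2) * _ :=
                mul_le_mul_of_nonneg_right (hcadd _ _) (by have := hs k; have := hs l; positivity)
            _ = _ := by ring
  · refine ⟨n.factorial / c n, by have := (hc0 n).le; positivity, fun k => ?_⟩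
    have h := (hsum _ (hs k)).le_tsum n fun j _ => hnn _ (hs k) j
    rw [div_mul_eq_mul_div, le_div_iff₀ (hc0 n)]
    have : s k ^ n * c n = n.factorial * (c n * (s k ^ n / n.factorial)) := by
      field_simp
    rw [this]
    gcongr
  · have hp : Summable fun p : ℕ × (Fin d → ℤ) =>
        c p.1 * (s p.2 ^ p.1 / p.1.factorial) * M p.2 := by
      rw [summable_prod_of_nonneg fun p => mul_nonneg (hnn _ (hs _) _) (hM.1 _)]
      refine ⟨fun n => ((hM.2 n).mul_left (c n / n.factorial)).congr fun k => ?_, ?_⟩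
      · simp only [s]; ring
      · refine ((Real.summable_pow_div_factorial 1).mul_left (1 + A 0)).of_nonneg_of_le
          (fun n => tsum_nonneg fun k => mul_nonneg (hnn _ (hs _) _) (hM.1 _)) fun n => ?_
        have : ∀ k, c n * (s k ^ n / n.factorial) * M k =
            (c n / n.factorial) * ((1 + ‖k‖) ^ n * M k) := fun k => by simp only [s]; ring
        simp_rw [this]
        rw [tsum_mul_left, one_pow, mul_one_div, div_mul_eq_mul_div]
        gcongr
        exact hcA n
    have := hp.prod_symm.prod
    refine this.congr fun k => ?_
    simp only [Prod.swap_prod_mk]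
    exact tsum_mul_right

end RapidDecay

/-- Convolution of families indexed by a group. -/
def conv {G R : Type*} [AddCommGroup G] [NormedCommRing R] (f g : G → R) (k : G) : R :=
  ∑' j, f j * g (k - j)

section conv

variable {G R : Type*} [AddCommGroup G] [NormedCommRing R]

theorem conv_neg [StarRing R] [ContinuousStar R] {f g : G → R} (hf : ∀ k, f (-k) = star (f k))
    (hg : ∀ k, g (-k) = star (g k)) (k : G) : conv f g (-k) = star (conv f g k) := by
  unfold conv
  rw [tsum_star, ← (Equiv.neg G).tsum_eq]
  refine tsum_congr fun j => ?_
  rw [Equiv.neg_apply, hf, star_mul', ← hg, neg_sub, sub_neg_eq_add, neg_add_eq_sub]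

theorem conv_self_sub_conv_self [CompleteSpace R] {f g f' g' : G → R}
    (hf : Summable fun k => ‖f k‖) (hg : Summable fun k => ‖g k‖)
    (hf' : Summable fun k => ‖f' k‖) (hg' : Summable fun k => ‖g' k‖) (k : G) :
    conv f g k - conv f' g' k = conv (f - f') g k + conv f' (g - g') k := by
  have h1 := summable_conv_term hf hg k
  have h2 := summable_conv_term hf' hg k
  have h3 := summable_conv_term hf' hg' k
  simp only [conv, Pi.sub_apply, sub_mul, mul_sub]
  rw [h1.tsum_sub h2, h2.tsum_sub h3]
  abel

theorem norm_conv_le [CompleteSpace R] {f g : G → R}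
    (hf : Summable fun k => ‖f k‖) (hg : Summable fun k => ‖g k‖) (k : G) :
    ‖conv f g k‖ ≤ conv (fun k => ‖f k‖) (fun k => ‖g k‖) k := by
  have h := summable_conv_term (R := ℝ) (f := fun k => ‖f k‖) (g := fun k => ‖g k‖)
    (by simpa using hf) (by simpa using hg) k
  exact tsum_of_norm_bounded h.hasSum fun j => norm_mul_le _ _

end conv

/-- The solution operator `f ↦ (t ↦ ∫₀ᵗ e^{-r(t-s)} f(s) ds)` of `y' = -r y + f`, `y(0) = 0`. -/
def duhamel {T : ℝ} (hT : 0 ≤ T) (r : ℝ) : C(Icc (0 : ℝ) T, ℂ) →+ C(Icc (0 : ℝ) T, ℂ) where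
  toFun f := ⟨fun t => Real.exp (-(r * t)) •
      ∫ s in (0 : ℝ)..t, Real.exp (r * s) • IccExtend hT f s, by
    have hc : Continuous fun s => Real.exp (r * s) • IccExtend hT f s := by
      have := f.continuous.Icc_extend' (h := hT); fun_prop
    have h2 := intervalIntegral.continuous_primitive (μ := volume)
      (fun a b => hc.intervalIntegrable a b) 0
    fun_prop⟩
  map_zero' := by ext t; simp [IccExtend]
  map_add' f g := by
    ext t
    have hf : Continuous fun s => Real.exp (r * s) • IccExtend hT f s := by
      have := f.continuous.Icc_extend' (h := hT); fun_prop
    have hg : Continuous fun s => Real.exp (r * s) • IccExtend hT g s := by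
      have := g.continuous.Icc_extend' (h := hT); fun_prop
    simp only [ContinuousMap.coe_mk, ContinuousMap.add_apply]
    rw [← smul_add, ← intervalIntegral.integral_add (hf.intervalIntegrable _ _)
      (hg.intervalIntegrable _ _)]
    simp [IccExtend]

section duhamel

variable {T : ℝ} (hT : 0 ≤ T) (r : ℝ) (f : C(Icc (0 : ℝ) T, ℂ))

theorem duhamel_apply (t : Icc (0 : ℝ) T) : duhamel hT r f t = Real.exp (-(r * t)) •
    ∫ s in (0 : ℝ)..t, Real.exp (r * s) • IccExtend hT f s := rfl

theorem duhamel_star : duhamel hT r (star f) = star (duhamel hT r f) := by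
  ext t
  rw [ContinuousMap.star_apply, duhamel_apply, duhamel_apply, RCLike.star_def,
    Complex.real_smul, Complex.real_smul, map_mul, Complex.conj_ofReal,
    ← intervalIntegral.intervalIntegral_conj]
  simp [IccExtend, ← Complex.exp_conj]

theorem sqrt_mul_norm_duhamel_le {r : ℝ} (hr : 0 ≤ r) :
    √r * ‖duhamel hT r f‖ ≤ √T * ‖f‖ := by
  suffices h : ∀ t : Icc (0 : ℝ) T, √r * ‖duhamel hT r f t‖ ≤ √T * ‖f‖ by
    rcases hr.eq_or_lt with h0 | h0
    · rw [← h0, Real.sqrt_zero, zero_mul]; positivity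
    · have hs : 0 < √r := Real.sqrt_pos.2 h0
      rw [← le_div_iff₀' hs, ContinuousMap.norm_le _ (by positivity)]
      intro t
      rw [le_div_iff₀' hs]
      exact h t
  intro t
  obtain ⟨t, ht0, htT⟩ := t
  rw [duhamel_apply, norm_smul, Real.norm_eq_abs, abs_of_pos (Real.exp_pos _)]
  set I : ℝ := Real.exp (-(r * t)) * ∫ s in (0 : ℝ)..t, Real.exp (r * s) with hI
  have hexpc : Continuous fun s => Real.exp (r * s) := by fun_prop
  have hI0 : 0 ≤ I := mul_nonneg (Real.exp_pos _).le
    (intervalIntegral.integral_nonneg ht0 fun s _ => (Real.exp_pos _).le)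
  have h1 : ‖∫ s in (0 : ℝ)..t, Real.exp (r * s) • IccExtend hT f s‖ ≤
      (∫ s in (0 : ℝ)..t, Real.exp (r * s)) * ‖f‖ := by
    rw [← intervalIntegral.integral_mul_const]
    refine intervalIntegral.norm_integral_le_of_norm_le ht0 (.of_forall fun s _ => ?_)
      ((hexpc.mul continuous_const).intervalIntegrable _ _)
    rw [norm_smul, Real.norm_eq_abs, abs_of_pos (Real.exp_pos _)]
    have := f.norm_coe_le_norm (projIcc 0 T hT s)
    gcongr
    exact this
  have hIT : I ≤ T := by
    have : (∫ s in (0 : ℝ)..t, Real.exp (r * s)) ≤ ∫ s in (0 : ℝ)..t, Real.exp (r * t) := by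
      refine intervalIntegral.integral_mono_on ht0 (hexpc.intervalIntegrable _ _)
        (continuous_const.intervalIntegrable _ _) fun s hs => ?_
      exact Real.exp_le_exp.2 (mul_le_mul_of_nonneg_left hs.2 hr)
    rw [intervalIntegral.integral_const, sub_zero, smul_eq_mul] at this
    calc I ≤ Real.exp (-(r * t)) * (t * Real.exp (r * t)) := by rw [hI]; gcongr
      _ = t := by rw [mul_left_comm, ← Real.exp_add]; simp
      _ ≤ T := htT
  have hrI : r * I ≤ 1 := by
    have h2 : r * (∫ s in (0 : ℝ)..t, Real.exp (r * s)) = Real.exp (r * t) - 1 := by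
      rw [← intervalIntegral.integral_const_mul]
      have : ∀ s ∈ uIcc 0 t, HasDerivAt (fun s => Real.exp (r * s)) (r * Real.exp (r * s)) s := by
        intro s _
        have := ((hasDerivAt_id s).const_mul r).exp
        simpa [mul_comm] using this
      rw [intervalIntegral.integral_eq_sub_of_hasDerivAt this
        ((continuous_const.mul hexpc).intervalIntegrable _ _)]
      simp
    calc r * I = Real.exp (-(r * t)) * (r * ∫ s in (0 : ℝ)..t, Real.exp (r * s)) := by
          rw [hI]; ring
      _ = 1 - Real.exp (-(r * t)) := by
          rw [h2, mul_sub, ← Real.exp_add]; simp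
      _ ≤ 1 := by linarith [Real.exp_pos (-(r * t))]
  have hsq : √r * I ≤ √T := by
    refine Real.le_sqrt_of_sq_le ?_
    rw [mul_pow, Real.sq_sqrt hr]
    nlinarith
  calc √r * (Real.exp (-(r * t)) * ‖∫ s in (0 : ℝ)..t, Real.exp (r * s) • IccExtend hT f s‖)
      ≤ √r * (Real.exp (-(r * t)) * ((∫ s in (0 : ℝ)..t, Real.exp (r * s)) * ‖f‖)) := by gcongr
    _ = (√r * I) * ‖f‖ := by rw [hI]; ring
    _ ≤ _ := by gcongr

theorem hasDerivWithinAt_duhamel (z : ℂ) {t : ℝ} (ht : t ∈ Icc 0 T) :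
    HasDerivWithinAt
      (fun t => Real.exp (-(r * t)) • z + IccExtend hT (duhamel hT r f) t)
      (-r * (Real.exp (-(r * t)) • z + IccExtend hT (duhamel hT r f) t) + IccExtend hT f t)
      (Icc 0 T) t := by
  have hc : Continuous fun s => Real.exp (r * s) • IccExtend hT f s := by
    have := f.continuous.Icc_extend' (h := hT); fun_prop
  have h1 : HasDerivAt (fun t : ℝ => ∫ s in (0 : ℝ)..t, Real.exp (r * s) • IccExtend hT f s)
      (Real.exp (r * t) • IccExtend hT f t) t :=
    intervalIntegral.integral_hasDerivAt_right (hc.intervalIntegrable _ _)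
      hc.stronglyMeasurable.stronglyMeasurableAtFilter hc.continuousAt
  have h2 : HasDerivAt (fun t : ℝ => Real.exp (-(r * t))) (-r * Real.exp (-(r * t))) t := by
    have := ((hasDerivAt_id t).const_mul r).neg.exp
    simpa [mul_comm] using this
  have h3 := (h2.smul_const z).add (h2.smul h1)
  have heq : ∀ s ∈ Icc (0 : ℝ) T, IccExtend hT (duhamel hT r f) s =
      Real.exp (-(r * s)) • ∫ s in (0 : ℝ)..s, Real.exp (r * s) • IccExtend hT f s := by
    intro s hs
    rw [IccExtend_of_mem hT _ hs, duhamel_apply]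
  refine (h3.hasDerivWithinAt.congr (fun s hs => ?_) ?_).congr_deriv ?_
  · rw [heq s hs]; rfl
  · rw [heq t ht]; rfl
  · rw [heq t ht]
    have he : ((Real.exp (-(r * t)) : ℝ) : ℂ) * (Real.exp (r * t) : ℝ) = 1 := by
      rw [← Complex.ofReal_mul, ← Real.exp_add]; simp
    simp only [Complex.real_smul]
    push_cast at he ⊢
    linear_combination (IccExtend hT f t) * he

end duhamel

theorem lp_one_summable {I E : Type*} [NormedAddCommGroup E] (x : lp (fun _ : I => E) 1) :
    Summable fun i => ‖x i‖ := by
  simpa using (lp.memℓp x).summable (by simp)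

theorem lp_one_norm {I E : Type*} [NormedAddCommGroup E] (x : lp (fun _ : I => E) 1) :
    ‖x‖ = ∑' i, ‖x i‖ := by
  simpa using lp.norm_eq_tsum_rpow (by simp) x

theorem memℓp_one_of_summable {I E : Type*} [NormedAddCommGroup E] {x : I → E}
    (h : Summable fun i => ‖x i‖) : Memℓp x 1 :=
  memℓp_gen (by simpa using h)

/-- The quadratic term of a semilinear system, seen on the Fourier side. -/
def quadTerm {ι G R : Type*} [Fintype ι] [AddCommGroup G] [NormedCommRing R] [NormedAlgebra ℂ R]
    (m : ι → ι → ι → G → ℂ) (f g : ι → G → R) (α : ι) (k : G) : R :=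
  ∑ β, ∑ γ, m α β γ k • conv (f β) (g γ) k

theorem norm_quadTerm_le {ι G R : Type*} [Fintype ι] [AddCommGroup G] [NormedCommRing R]
    [NormedAlgebra ℂ R] (m : ι → ι → ι → G → ℂ) (f g : ι → G → R) (α : ι) (k : G) {K : ℝ}
    (hK : ∀ β γ, ‖m α β γ k‖ ≤ K) :
    ‖quadTerm m f g α k‖ ≤ K * ∑ β, ∑ γ, ‖conv (f β) (g γ) k‖ := by
  rw [Finset.mul_sum]
  refine (norm_sum_le _ _).trans (Finset.sum_le_sum fun β _ => ?_)
  rw [Finset.mul_sum]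
  refine (norm_sum_le _ _).trans (Finset.sum_le_sum fun γ _ => ?_)
  exact (norm_smul_le _ _).trans (mul_le_mul_of_nonneg_right (hK β γ) (norm_nonneg _))

/-- Multiplication of continuous functions by a real scalar. -/
def scale {T : ℝ} (a : ℝ) : C(Icc (0 : ℝ) T, ℂ) →+ C(Icc (0 : ℝ) T, ℂ) where
  toFun f := ⟨fun t => a • f t, by fun_prop⟩
  map_zero' := by ext t; simp
  map_add' f g := by ext t; simp

section

variable {T : ℝ} (a : ℝ) (f : C(Icc (0 : ℝ) T, ℂ))

theorem scale_apply (t : Icc (0 : ℝ) T) : scale a f t = a • f t := rfl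

theorem star_scale : star (scale a f) = scale a (star f) := by
  ext t
  simp [scale_apply]

theorem scale_inv_scale {a : ℝ} (ha : 0 < a) : scale a⁻¹ (scale a f) = f := by
  ext t
  rw [scale_apply, scale_apply, inv_smul_smul₀ ha.ne']

theorem norm_scale {a : ℝ} (ha : 0 < a) : ‖scale a f‖ = a * ‖f‖ := by
  have h : ∀ {a : ℝ} (_ : 0 < a) (f : C(Icc (0 : ℝ) T, ℂ)), ‖scale a f‖ ≤ a * ‖f‖ := by
    intro a ha f
    rw [ContinuousMap.norm_le _ (by positivity)]
    intro t
    rw [scale_apply, norm_smul, Real.norm_eq_abs, abs_of_pos ha]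
    have := f.norm_coe_le_norm t
    gcongr
  refine (h ha f).antisymm ?_
  have h2 := h (inv_pos.2 ha) (scale a f)
  rw [scale_inv_scale f ha] at h2
  rwa [le_inv_mul_iff₀ ha] at h2

theorem summable_scale_inv {I : Type*} {w : I → ℝ} (hw1 : ∀ k, 1 ≤ w k)
    {x : I → C(Icc (0 : ℝ) T, ℂ)} (hx : Summable fun k => ‖x k‖) :
    Summable fun k => ‖scale (w k)⁻¹ (x k)‖ := by
  refine hx.of_nonneg_of_le (fun _ => norm_nonneg _) fun k => ?_
  rw [norm_scale _ (inv_pos.2 (one_pos.trans_le (hw1 k)))]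
  exact mul_le_of_le_one_left (norm_nonneg _) (inv_le_one_of_one_le₀ (hw1 k))

end

section

variable {ι : Type*} [Fintype ι] {d : ℕ}

theorem norm_quadTerm_duhamel_le {T : ℝ} (hT : 0 ≤ T) (r : ι → (Fin d → ℤ) → ℝ)
    (hr : ∀ α k, 0 ≤ r α k) (m : ι → ι → ι → (Fin d → ℤ) → ℂ) (C : ℝ) (hC : 0 ≤ C)
    (hm : ∀ α β γ k, ‖m α β γ k‖ ≤ C * √(r α k))
    (f g : ι → (Fin d → ℤ) → C(Icc (0 : ℝ) T, ℂ)) (α : ι) (k : Fin d → ℤ) :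
    ‖duhamel hT (r α k) (quadTerm m f g α k)‖ ≤
      C * √T * ∑ β, ∑ γ, ‖conv (f β) (g γ) k‖ := by
  have h2 := norm_quadTerm_le m f g α k fun β γ => hm α β γ k
  rcases (Real.sqrt_nonneg (r α k)).eq_or_lt' with h0 | h0
  · rw [h0, mul_zero, zero_mul] at h2
    rw [norm_le_zero_iff.1 h2, map_zero, norm_zero]
    positivity
  · have h1 := sqrt_mul_norm_duhamel_le hT (quadTerm m f g α k) (hr α k)
    refine le_of_mul_le_mul_left (h1.trans ?_) h0
    calc √T * ‖quadTerm m f g α k‖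
        ≤ √T * (C * √(r α k) * ∑ β, ∑ γ, ‖conv (f β) (g γ) k‖) := by gcongr
      _ = _ := by ring

theorem quadTerm_neg {R : Type*} [NormedCommRing R] [NormedAlgebra ℂ R] [StarRing R]
    [ContinuousStar R] [StarModule ℂ R] {m : ι → ι → ι → (Fin d → ℤ) → ℂ}
    (hm : ∀ α β γ k, m α β γ (-k) = star (m α β γ k)) {f g : ι → (Fin d → ℤ) → R}
    (hf : ∀ α k, f α (-k) = star (f α k)) (hg : ∀ α k, g α (-k) = star (g α k))
    (α : ι) (k : Fin d → ℤ) : quadTerm m f g α (-k) = star (quadTerm m f g α k) := by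
  simp only [quadTerm, star_sum, star_smul]
  refine Finset.sum_congr rfl fun β _ => Finset.sum_congr rfl fun γ _ => ?_
  rw [conv_neg (hf β) (hg γ), hm]

theorem quadTerm_self_sub {R : Type*} [NormedCommRing R] [NormedAlgebra ℂ R] [CompleteSpace R]
    (m : ι → ι → ι → (Fin d → ℤ) → ℂ) {f g : ι → (Fin d → ℤ) → R}
    (hf : ∀ α, Summable fun k => ‖f α k‖) (hg : ∀ α, Summable fun k => ‖g α k‖)
    (α : ι) (k : Fin d → ℤ) :
    quadTerm m f f α k - quadTerm m g g α k =
      quadTerm m (f - g) f α k + quadTerm m g (f - g) α k := by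
  simp only [quadTerm, ← Finset.sum_sub_distrib, ← Finset.sum_add_distrib]
  refine Finset.sum_congr rfl fun β _ => Finset.sum_congr rfl fun γ _ => ?_
  rw [← smul_sub, ← smul_add, conv_self_sub_conv_self (hf β) (hf γ) (hg β) (hg γ)]
  rfl

/-- The bilinear operator of the mild formulation, in weighted Fourier coefficients. -/
def mildTerm {T : ℝ} (hT : 0 ≤ T) (r : ι → (Fin d → ℤ) → ℝ) (m : ι → ι → ι → (Fin d → ℤ) → ℂ)
    (w : (Fin d → ℤ) → ℝ) (x y : ι × (Fin d → ℤ) → C(Icc (0 : ℝ) T, ℂ)) (p : ι × (Fin d → ℤ)) :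
    C(Icc (0 : ℝ) T, ℂ) :=
  scale (w p.2) (duhamel hT (r p.1 p.2) (quadTerm m (fun β k => scale (w k)⁻¹ (x (β, k)))
    (fun γ k => scale (w k)⁻¹ (y (γ, k))) p.1 p.2))

variable {T : ℝ} (hT : 0 ≤ T) {r : ι → (Fin d → ℤ) → ℝ} {m : ι → ι → ι → (Fin d → ℤ) → ℂ}
  {w : (Fin d → ℤ) → ℝ} {C : ℝ}

theorem norm_mildTerm_le (hr : ∀ α k, 0 ≤ r α k) (hC : 0 ≤ C)
    (hm : ∀ α β γ k, ‖m α β γ k‖ ≤ C * √(r α k)) (hw1 : ∀ k, 1 ≤ w k)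
    (hwm : ∀ k l, w (k + l) ≤ w k * w l)
    (x y : lp (fun _ : ι × (Fin d → ℤ) => C(Icc (0 : ℝ) T, ℂ)) 1) (p : ι × (Fin d → ℤ)) :
    ‖mildTerm hT r m w x y p‖ ≤
      C * √T * ∑ β, ∑ γ, conv (fun k => ‖x (β, k)‖) (fun k => ‖y (γ, k)‖) p.2 := by
  obtain ⟨α, k⟩ := p
  have hw0 : ∀ k, 0 < w k := fun k => one_pos.trans_le (hw1 k)
  rw [mildTerm, norm_scale _ (hw0 k)]
  refine (mul_le_mul_of_nonneg_left (norm_quadTerm_duhamel_le hT r hr m C hC hm _ _ α k)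
    (hw0 k).le).trans ?_
  rw [mul_left_comm]
  refine mul_le_mul_of_nonneg_left ?_ (by positivity)
  rw [Finset.mul_sum]
  refine Finset.sum_le_sum fun β _ => ?_
  rw [Finset.mul_sum]
  refine Finset.sum_le_sum fun γ _ => ?_
  have hx := summable_scale_inv hw1 ((lp_one_summable x).prod_factor β)
  have hy := summable_scale_inv hw1 ((lp_one_summable y).prod_factor γ)
  refine (mul_le_mul_of_nonneg_left (norm_conv_le hx hy k) (hw0 k).le).trans ?_
  unfold conv
  rw [← tsum_mul_left]
  refine Summable.tsum_le_tsum (fun j => ?_)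
    ((summable_conv_term hx.norm hy.norm k).mul_left _)
    (summable_conv_term ((lp_one_summable x).prod_factor β).norm
      ((lp_one_summable y).prod_factor γ).norm k)
  simp only [norm_scale _ (inv_pos.2 (hw0 _))]
  have h1 : w k ≤ w j * w (k - j) := by simpa using hwm j (k - j)
  have h2 := hw0 j
  have h3 := hw0 (k - j)
  calc w k * ((w j)⁻¹ * ‖x (β, j)‖ * ((w (k - j))⁻¹ * ‖y (γ, k - j)‖))
      ≤ (w j * w (k - j)) * ((w j)⁻¹ * ‖x (β, j)‖ * ((w (k - j))⁻¹ * ‖y (γ, k - j)‖)) := by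
        gcongr
    _ = _ := by field_simp

theorem hasSum_mildBound (x y : lp (fun _ : ι × (Fin d → ℤ) => C(Icc (0 : ℝ) T, ℂ)) 1) (A : ℝ)
    (hA : 0 ≤ A) :
    HasSum (fun p : ι × (Fin d → ℤ) =>
      A * ∑ β, ∑ γ, conv (fun k => ‖x (β, k)‖) (fun k => ‖y (γ, k)‖) p.2)
      (A * Fintype.card ι * ‖x‖ * ‖y‖) := by
  have hx := lp_one_summable x
  have hy := lp_one_summable y
  have h1 : HasSum (fun k => A * ∑ β, ∑ γ, conv (fun k => ‖x (β, k)‖) (fun k => ‖y (γ, k)‖) k)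
      (A * (‖x‖ * ‖y‖)) := by
    have h := hasSum_sum fun β (_ : β ∈ Finset.univ) => hasSum_sum fun γ
      (_ : γ ∈ Finset.univ) => hasSum_conv (hx.prod_factor β).norm (hy.prod_factor γ).norm
    rw [← Finset.sum_mul_sum, ← tsum_fintype (L := .unconditional _),
      ← tsum_fintype (L := .unconditional _), ← hx.tsum_prod, ← hy.tsum_prod,
      ← lp_one_norm, ← lp_one_norm] at h
    exact h.mul_left A
  have h0 : ∀ k, 0 ≤ A * ∑ β, ∑ γ, conv (fun k => ‖x (β, k)‖) (fun k => ‖y (γ, k)‖) k :=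
    fun k => mul_nonneg hA <| Finset.sum_nonneg fun β _ => Finset.sum_nonneg fun γ _ =>
      tsum_nonneg fun j => by positivity
  have hs : Summable (fun p : ι × (Fin d → ℤ) =>
      A * ∑ β, ∑ γ, conv (fun k => ‖x (β, k)‖) (fun k => ‖y (γ, k)‖) p.2) := by
    rw [summable_prod_of_nonneg fun p => h0 p.2]
    exact ⟨fun _ => h1.summable, .of_finite⟩
  have := hs.hasSum
  rw [hs.tsum_prod, tsum_fintype] at this
  simp only [h1.tsum_eq, Finset.sum_const, Finset.card_univ, nsmul_eq_mul] at this
  convert this using 1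
  ring

theorem mildTerm_self_sub {x y z : ι × (Fin d → ℤ) → C(Icc (0 : ℝ) T, ℂ)} (hz : z = x - y)
    (hx : ∀ β, Summable fun k => ‖scale (w k)⁻¹ (x (β, k))‖)
    (hy : ∀ β, Summable fun k => ‖scale (w k)⁻¹ (y (β, k))‖) :
    mildTerm hT r m w x x - mildTerm hT r m w y y =
      mildTerm hT r m w z x + mildTerm hT r m w y z := by
  funext ⟨α, k⟩
  have h : (fun β k => scale (w k)⁻¹ (z (β, k))) =
      (fun β k => scale (w k)⁻¹ (x (β, k))) - fun β k => scale (w k)⁻¹ (y (β, k)) := by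
    funext β k
    simp [hz]
  have h2 := quadTerm_self_sub m hx hy α k
  rw [← h] at h2
  simp only [mildTerm, Pi.sub_apply, Pi.add_apply]
  rw [← map_sub, ← map_sub, ← map_add, ← map_add, h2]

theorem mildTerm_neg (hr : ∀ α k, r α (-k) = r α k) (hw : ∀ k, w (-k) = w k)
    (hm : ∀ α β γ k, m α β γ (-k) = star (m α β γ k))
    {x : ι × (Fin d → ℤ) → C(Icc (0 : ℝ) T, ℂ)} (hx : ∀ α k, x (α, -k) = star (x (α, k)))
    (α : ι) (k : Fin d → ℤ) :
    mildTerm hT r m w x x (α, -k) = star (mildTerm hT r m w x x (α, k)) := by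
  have h : ∀ β k, scale (w (-k))⁻¹ (x (β, -k)) = star (scale (w k)⁻¹ (x (β, k))) := fun β k => by
    rw [hw, hx, star_scale]
  simp only [mildTerm]
  rw [hr, hw, quadTerm_neg hm h h, duhamel_star, star_scale]

/-- The solution `t ↦ e^{-rt} z` of `y' = -r y`, `y(0) = z`. -/
def heatFlow (T r : ℝ) (z : ℂ) : C(Icc (0 : ℝ) T, ℂ) :=
  ⟨fun t => Real.exp (-(r * t)) • z, by fun_prop⟩

theorem heatFlow_apply (T r : ℝ) (z : ℂ) (t : Icc (0 : ℝ) T) :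
    heatFlow T r z t = Real.exp (-(r * t)) • z := rfl

theorem exists_weighted_mild_solution (hr : ∀ α k, 0 ≤ r α k) (hC : 0 ≤ C)
    (hm : ∀ α β γ k, ‖m α β γ k‖ ≤ C * √(r α k)) (hrneg : ∀ α k, r α (-k) = r α k)
    (hmneg : ∀ α β γ k, m α β γ (-k) = star (m α β γ k)) (c₀ : ι → (Fin d → ℤ) → ℂ)
    (hc₀neg : ∀ α k, c₀ α (-k) = star (c₀ α k)) (hw1 : ∀ k, 1 ≤ w k)
    (hwneg : ∀ k, w (-k) = w k) (hwm : ∀ k l, w (k + l) ≤ w k * w l)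
    (hRs : Summable fun p : ι × (Fin d → ℤ) => w p.2 * ‖c₀ p.1 p.2‖) :
    ∃ (T : ℝ) (hT : 0 < T) (y : ι × (Fin d → ℤ) → C(Icc (0 : ℝ) T, ℂ)),
      (Summable fun p => ‖y p‖) ∧ (∀ α k, y (α, -k) = star (y (α, k))) ∧
      ∀ p, y p = scale (w p.2) (heatFlow T (r p.1 p.2) (c₀ p.1 p.2)) + mildTerm hT.le r m w y y p := by
  have hw0 : ∀ k, 0 < w k := fun k => one_pos.trans_le (hw1 k)
  set R : ℝ := ∑' p : ι × (Fin d → ℤ), w p.2 * ‖c₀ p.1 p.2‖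
  have hR : 0 ≤ R := tsum_nonneg fun p => mul_nonneg (hw0 _).le (norm_nonneg _)
  set q : ℝ := 1 / (8 * (C * Fintype.card ι + 1) * (R + 1))
  have hq : 0 < q := by positivity
  have hT : (0 : ℝ) ≤ q ^ 2 := by positivity
  set X := lp (fun _ : ι × (Fin d → ℤ) => C(Icc (0 : ℝ) (q ^ 2), ℂ)) 1
  set A : ι × (Fin d → ℤ) → C(Icc (0 : ℝ) (q ^ 2), ℂ) := fun p =>
    scale (w p.2) (heatFlow _ (r p.1 p.2) (c₀ p.1 p.2)) with hA
  have hAn : ∀ p, ‖A p‖ ≤ w p.2 * ‖c₀ p.1 p.2‖ := by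
    intro p
    rw [hA, norm_scale _ (hw0 _)]
    refine mul_le_mul_of_nonneg_left ?_ (hw0 _).le
    rw [ContinuousMap.norm_le _ (norm_nonneg _)]
    intro t
    rw [heatFlow_apply, norm_smul, Real.norm_eq_abs, abs_of_pos (Real.exp_pos _)]
    refine mul_le_of_le_one_left (norm_nonneg _) (Real.exp_le_one_iff.2 ?_)
    linarith [mul_nonneg (hr p.1 p.2) t.2.1]
  have hAs : Summable fun p => ‖A p‖ := hRs.of_nonneg_of_le (fun _ => norm_nonneg _) hAn
  let a : X := ⟨A, memℓp_one_of_summable hAs⟩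
  have ha : ‖a‖ ≤ R := by
    rw [lp_one_norm]
    exact hAs.tsum_le_tsum hAn hRs
  have hCq : 0 ≤ C * √(q ^ 2) := by positivity
  have hBs : ∀ x y : X, Summable fun p => ‖mildTerm hT r m w x y p‖ := fun x y =>
    (hasSum_mildBound x y _ hCq).summable.of_nonneg_of_le (fun _ => norm_nonneg _)
      (norm_mildTerm_le hT hr hC hm hw1 hwm x y)
  let B : X → X → X := fun x y => ⟨mildTerm hT r m w x y, memℓp_one_of_summable (hBs x y)⟩
  have hBn : ∀ x y, ‖B x y‖ ≤ C * √(q ^ 2) * Fintype.card ι * ‖x‖ * ‖y‖ := fun x y => by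
    rw [lp_one_norm, ← (hasSum_mildBound x y _ hCq).tsum_eq]
    exact (hBs x y).tsum_le_tsum (norm_mildTerm_le hT hr hC hm hw1 hwm x y)
      (hasSum_mildBound x y _ hCq).summable
  have hBsub : ∀ x y, B x x - B y y = B (x - y) x + B y (x - y) := fun x y =>
    Subtype.ext (mildTerm_self_sub hT (lp.coeFn_sub x y) 
      (fun β => summable_scale_inv hw1 ((lp_one_summable x).prod_factor β))
      (fun β => summable_scale_inv hw1 ((lp_one_summable y).prod_factor β)))
  have hsmall : 8 * (C * √(q ^ 2) * Fintype.card ι) * ‖a‖ ≤ 1 := by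
    rw [Real.sqrt_sq hq.le]
    calc 8 * (C * q * Fintype.card ι) * ‖a‖
        ≤ 8 * ((C * Fintype.card ι + 1) * q) * (R + 1) := by
          have h1 : C * q * Fintype.card ι ≤ (C * Fintype.card ι + 1) * q := by linarith
          have h2 : ‖a‖ ≤ R + 1 := by linarith
          gcongr
      _ = 1 := by simp only [q]; field_simp
  obtain ⟨x, hxS, hx⟩ := exists_eq_add_bilin B _ (by positivity) hBn hBsub a hsmall
    {x : X | ∀ α k, x (α, -k) = star (x (α, k))} (by
      simp only [ofPred_forall]
      refine isClosed_iInter fun α => isClosed_iInter fun k => ?_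
      have hev : ∀ p, Continuous fun x : X => x p := fun p =>
        (continuous_apply p).comp (lp.uniformContinuous_coe.continuous)
      exact isClosed_eq (hev _) (continuous_star.comp (hev _)))
    (by
      intro α k
      change A (α, -k) = star (A (α, k))
      ext t
      simp [hA, scale_apply, heatFlow_apply, hwneg, hrneg, hc₀neg, ← Complex.exp_conj])
    (by
      intro x hx α k
      change A (α, -k) + mildTerm hT r m w x x (α, -k) =
        star (A (α, k) + mildTerm hT r m w x x (α, k))
      rw [star_add, mildTerm_neg hT hrneg hwneg hmneg hx]
      congr 1
      ext t
      simp [hA, scale_apply, heatFlow_apply, hwneg, hrneg, hc₀neg, ← Complex.exp_conj])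
  exact ⟨q ^ 2, by positivity, x, lp_one_summable x, hxS, fun p => congrArg (fun z : X => z p) hx⟩

/-- Local existence for semilinear parabolic systems with quadratic nonlinearity of order one,
on the Fourier side, for rapidly decaying data. -/
theorem exists_fourier_solution (hr : ∀ α k, 0 ≤ r α k) (hC : 0 ≤ C)
    (hm : ∀ α β γ k, ‖m α β γ k‖ ≤ C * √(r α k)) (hrneg : ∀ α k, r α (-k) = r α k)
    (hmneg : ∀ α β γ k, m α β γ (-k) = star (m α β γ k)) (c₀ : ι → (Fin d → ℤ) → ℂ)
    (hc₀ : ∀ α, RapidDecay fun k => ‖c₀ α k‖) (hc₀neg : ∀ α k, c₀ α (-k) = star (c₀ α k)) :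
    ∃ T : ℝ, 0 < T ∧ ∃ c : ι → (Fin d → ℤ) → ℝ → ℂ,
      (∀ α, (∀ k, Continuous (c α k)) ∧ ∃ M, RapidDecay M ∧ ∀ k t, ‖c α k t‖ ≤ M k) ∧
      (∀ α k t, c α (-k) t = star (c α k t)) ∧ (∀ α k, c α k 0 = c₀ α k) ∧
      ∀ α k, ∀ t ∈ Icc (0 : ℝ) T, HasDerivWithinAt (c α k)
        (-r α k * c α k t + quadTerm m (fun β k => c β k t) (fun β k => c β k t) α k)
        (Icc 0 T) t := by
  obtain ⟨w, hw1, hwneg, hwm, hwp, hwM⟩ :=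
    (RapidDecay.sum Finset.univ fun α _ => hc₀ α).exists_weight
  have hw0 : ∀ k, 0 < w k := fun k => one_pos.trans_le (hw1 k)
  have hws : ∀ α, Summable fun k => w k * ‖c₀ α k‖ := fun α =>
    hwM.of_nonneg_of_le (fun k => mul_nonneg (hw0 k).le (norm_nonneg _)) fun k => by
      have := (hw0 k).le
      gcongr
      exact Finset.single_le_sum (f := fun α => ‖c₀ α k‖) (fun i _ => norm_nonneg _)
        (Finset.mem_univ α)
  have hRs : Summable fun p : ι × (Fin d → ℤ) => w p.2 * ‖c₀ p.1 p.2‖ := by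
    rw [summable_prod_of_nonneg fun p => mul_nonneg (hw0 _).le (norm_nonneg _)]
    exact ⟨hws, .of_finite⟩
  obtain ⟨T, hT0, y, hys, hyneg, hyc⟩ := exists_weighted_mild_solution hr hC hm hrneg hmneg c₀
    hc₀neg hw1 hwneg hwm hRs
  have hT := hT0.le
  set f : ι → (Fin d → ℤ) → C(Icc (0 : ℝ) T, ℂ) := fun β k => scale (w k)⁻¹ (y (β, k)) with hf
  have hfs : ∀ β, Summable fun k => ‖f β k‖ := fun β =>
    summable_scale_inv hw1 (hys.prod_factor β)
  have hfe : ∀ α k t, IccExtend hT (f α k) t = Real.exp (-(r α k * (projIcc 0 _ hT t : ℝ))) • c₀ α k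
      + IccExtend hT (duhamel hT (r α k) (quadTerm m f f α k)) t := fun α k t => by
    have : f α k = heatFlow T (r α k) (c₀ α k) + duhamel hT (r α k) (quadTerm m f f α k) := by
      simp only [hf]
      rw [hyc (α, k), map_add, mildTerm, scale_inv_scale _ (hw0 k), scale_inv_scale _ (hw0 k)]
    conv_lhs => rw [this]
    rfl
  have hquad : ∀ α k t, IccExtend hT (quadTerm m f f α k : C(Icc (0 : ℝ) T, ℂ)) t =
      quadTerm m (fun β k => IccExtend hT (f β k) t) (fun β k => IccExtend hT (f β k) t) α k := by
    intro α k t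
    simp only [IccExtend, Function.comp_apply, quadTerm, ContinuousMap.coe_sum, Finset.sum_apply,
      ContinuousMap.coe_smul, Pi.smul_apply]
    refine Finset.sum_congr rfl fun β _ => Finset.sum_congr rfl fun γ _ => ?_
    congr 1
    have h := summable_conv_term (hfs β) (hfs γ) k
    have h2 := (ContinuousMap.evalCLM ℂ (projIcc 0 T hT t)).map_tsum h
    exact h2
  refine ⟨T, hT0, fun α k => IccExtend hT (f α k), fun α => ⟨fun k =>
    (f α k).continuous.Icc_extend', fun k => ‖f α k‖, ⟨fun _ => norm_nonneg _, fun n => ?_⟩,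
    fun k t => (f α k).norm_coe_le_norm _⟩, fun α k t => ?_, fun α k => ?_, fun α k t ht => ?_⟩
  · obtain ⟨D, hD0, hD⟩ := hwp n
    refine ((hys.prod_factor α).mul_left D).of_nonneg_of_le
      (fun k => by positivity) fun k => ?_
    have h1 : ‖f α k‖ = (w k)⁻¹ * ‖y (α, k)‖ := by
      rw [hf, norm_scale _ (inv_pos.2 (hw0 k))]
    beta_reduce
    rw [h1]
    have h2 := hw0 k
    calc (1 + ‖k‖) ^ n * ((w k)⁻¹ * ‖y (α, k)‖) ≤ (D * w k) * ((w k)⁻¹ * ‖y (α, k)‖) := by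
          gcongr; exact hD k
      _ = _ := by field_simp
  · have : f α (-k) = star (f α k) := by
      simp only [hf]
      rw [hyneg, hwneg, star_scale]
    beta_reduce
    rw [this]
    rfl
  · beta_reduce
    rw [hfe, IccExtend_of_mem hT _ (left_mem_Icc.2 hT), duhamel_apply, projIcc_left]
    simp
  · beta_reduce
    rw [← hquad, hfe]
    have h := hasDerivWithinAt_duhamel hT (r α k) (quadTerm m f f α k) (c₀ α k) ht
    refine (h.congr (fun s hs => ?_) ?_).congr_deriv ?_
    · rw [hfe, projIcc_of_mem hT hs]
    · rw [hfe, projIcc_of_mem hT ht]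
    · rw [projIcc_of_mem hT ht]

end

section

/-- Polynomial growth of a Fourier multiplier. -/
def PolyBdd {d : ℕ} (m : (Fin d → ℤ) → ℂ) : Prop :=
  ∃ (C : ℝ) (n : ℕ), 0 ≤ C ∧ ∀ k, ‖m k‖ ≤ C * (1 + ‖k‖) ^ n

/-- Continuous families of Fourier coefficients, rapidly decaying uniformly on `[0, T]`. -/
def IsCoeff {d : ℕ} (T : ℝ) (c : (Fin d → ℤ) → ℝ → ℂ) : Prop :=
  (∀ k, ContinuousOn (c k) (Icc 0 T)) ∧
    ∃ M, RapidDecay M ∧ ∀ k, ∀ t ∈ Icc (0 : ℝ) T, ‖c k t‖ ≤ M k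

/-- Families of Fourier coefficients that are `n` times differentiable in time on `[0, T]`, with
derivatives satisfying `IsCoeff`. -/
def SmoothCoeff {d : ℕ} (T : ℝ) : ℕ → ((Fin d → ℤ) → ℝ → ℂ) → Prop
  | 0, c => IsCoeff T c
  | n + 1, c => IsCoeff T c ∧ ∃ c', SmoothCoeff T n c' ∧
      ∀ k, ∀ t ∈ Icc (0 : ℝ) T, HasDerivWithinAt (c k) (c' k t) (Icc 0 T) t

variable {d : ℕ} {T : ℝ}

namespace IsCoeff

variable {a c : (Fin d → ℤ) → ℝ → ℂ}

theorem rapidDecay (hc : IsCoeff T c) {t : ℝ} (ht : t ∈ Icc 0 T) :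
    RapidDecay fun k => ‖c k t‖ := by
  obtain ⟨-, M, hM, hcM⟩ := hc
  exact hM.mono (fun _ => norm_nonneg _) fun k => hcM k t ht

theorem zero : IsCoeff T (fun (_ : Fin d → ℤ) _ => 0) :=
  ⟨fun _ => continuousOn_const, 0, ⟨fun _ => le_rfl, fun n => by simp⟩,
    fun k t _ => by simp⟩

theorem add (ha : IsCoeff T a) (hc : IsCoeff T c) : IsCoeff T (fun k t => a k t + c k t) := by
  obtain ⟨h1, M, hM, haM⟩ := ha
  obtain ⟨h2, N, hN, hcN⟩ := hc
  exact ⟨fun k => (h1 k).add (h2 k), _, hM.add hN, fun k t ht =>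
    (norm_add_le _ _).trans (add_le_add (haM k t ht) (hcN k t ht))⟩

theorem mul {m : (Fin d → ℤ) → ℂ} (hm : PolyBdd m) (hc : IsCoeff T c) :
    IsCoeff T (fun k t => m k * c k t) := by
  obtain ⟨C, n, hC, hm⟩ := hm
  obtain ⟨h2, N, hN, hcN⟩ := hc
  refine ⟨fun k => (h2 k).const_smul (m k), _, hN.poly_mul hC n, fun k t ht => ?_⟩
  rw [norm_mul]
  exact mul_le_mul (hm k) (hcN k t ht) (norm_nonneg _) (by positivity)

theorem conv (ha : IsCoeff T a) (hc : IsCoeff T c) :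
    IsCoeff T (fun k t => conv (fun j => a j t) (fun j => c j t) k) := by
  obtain ⟨h1, M, hM, haM⟩ := ha
  obtain ⟨h2, N, hN, hcN⟩ := hc
  have hs : ∀ k, Summable fun j => M j * N (k - j) := fun k =>
    summable_conv_term hM.summable.norm hN.summable.norm k
  have hb : ∀ k j, ∀ t ∈ Icc (0 : ℝ) T, ‖a j t * c (k - j) t‖ ≤ M j * N (k - j) := by
    intro k j t ht
    rw [norm_mul]
    exact mul_le_mul (haM _ t ht) (hcN _ t ht) (norm_nonneg _) (hM.1 _)
  exact ⟨fun k => continuousOn_tsum (fun j => (h1 j).mul (h2 (k - j))) (hs k) (hb k), _,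
    hM.conv hN, fun k t ht => tsum_of_norm_bounded (hs k).hasSum fun j => hb k j t ht⟩

end IsCoeff

theorem hasDerivWithinAt_conv {a a' c c' : (Fin d → ℤ) → ℝ → ℂ} (ha : IsCoeff T a)
    (ha' : IsCoeff T a') (hc : IsCoeff T c) (hc' : IsCoeff T c')
    (hda : ∀ k, ∀ t ∈ Icc (0 : ℝ) T, HasDerivWithinAt (a k) (a' k t) (Icc 0 T) t)
    (hdc : ∀ k, ∀ t ∈ Icc (0 : ℝ) T, HasDerivWithinAt (c k) (c' k t) (Icc 0 T) t)
    (k : Fin d → ℤ) {t : ℝ} (ht : t ∈ Icc 0 T) :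
    HasDerivWithinAt (fun t => conv (fun j => a j t) (fun j => c j t) k)
      (conv (fun j => a' j t) (fun j => c j t) k + conv (fun j => a j t) (fun j => c' j t) k)
      (Icc 0 T) t := by
  have hs : ∀ {f g : (Fin d → ℤ) → ℝ → ℂ} {t : ℝ}, IsCoeff T f → IsCoeff T g → t ∈ Icc 0 T →
      Summable fun j => f j t * g (k - j) t := fun hf hg ht =>
    summable_conv_term (hf.rapidDecay ht).summable (hg.rapidDecay ht).summable k
  have hsum := fun t ht => hs (t := t) ha hc ht
  have hL := ((hs ha' hc ht).hasSum.add (hs ha hc' ht).hasSum).mapL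
    (ContinuousLinearMap.toSpanSingletonCLE (𝕜 := ℝ) (E := ℂ)).toContinuousLinearMap
  obtain ⟨-, A, hA, haA⟩ := ha
  obtain ⟨-, A', hA', haA'⟩ := ha'
  obtain ⟨-, C, hC, hcC⟩ := hc
  obtain ⟨-, C', hC', hcC'⟩ := hc'
  refine (hasFDerivWithinAt_tsum_of_convex (convex_Icc 0 T)
    (f := fun j t => a j t * c (k - j) t)
    (f' := fun j t => ContinuousLinearMap.toSpanSingleton ℝ
      (a' j t * c (k - j) t + a j t * c' (k - j) t))
    ((summable_conv_term hA'.summable.norm hC.summable.norm k).add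
      (summable_conv_term hA.summable.norm hC'.summable.norm k))
    (fun j t ht => ((hda j t ht).mul (hdc _ t ht)).hasFDerivWithinAt) (fun j t ht => ?_)
    (fun t ht => hsum t ht) ht hL).hasDerivWithinAt.congr_deriv ?_
  · rw [ContinuousLinearMap.norm_toSpanSingleton]
    refine (norm_add_le _ _).trans (add_le_add ?_ ?_) <;> rw [norm_mul]
    · exact mul_le_mul (haA' _ t ht) (hcC _ t ht) (norm_nonneg _) (hA'.1 _)
    · exact mul_le_mul (haA _ t ht) (hcC' _ t ht) (norm_nonneg _) (hA.1 _)
  · simp [conv]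

namespace SmoothCoeff

variable {n : ℕ} {a c : (Fin d → ℤ) → ℝ → ℂ}

theorem isCoeff (hc : SmoothCoeff T n c) : IsCoeff T c := by
  cases n with
  | zero => exact hc
  | succ n => exact hc.1

theorem pred (hc : SmoothCoeff T (n + 1) c) : SmoothCoeff T n c := by
  induction n generalizing c with
  | zero => exact hc.1
  | succ n ih =>
    obtain ⟨h0, c', hc', h⟩ := hc
    exact ⟨h0, c', ih hc', h⟩

theorem zero : SmoothCoeff T n (fun (_ : Fin d → ℤ) _ => 0) := by
  induction n with
  | zero => exact IsCoeff.zero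
  | succ n ih => exact ⟨IsCoeff.zero, _, ih, fun k t _ => hasDerivWithinAt_const _ _ _⟩

theorem add (ha : SmoothCoeff T n a) (hc : SmoothCoeff T n c) :
    SmoothCoeff T n (fun k t => a k t + c k t) := by
  induction n generalizing a c with
  | zero => exact IsCoeff.add ha hc
  | succ n ih =>
    obtain ⟨h1, a', ha', hda⟩ := ha
    obtain ⟨h2, c', hc', hdc⟩ := hc
    exact ⟨h1.add h2, _, ih ha' hc', fun k t ht => (hda k t ht).add (hdc k t ht)⟩

theorem mul {m : (Fin d → ℤ) → ℂ} (hm : PolyBdd m) (hc : SmoothCoeff T n c) :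
    SmoothCoeff T n (fun k t => m k * c k t) := by
  induction n generalizing c with
  | zero => exact IsCoeff.mul hm hc
  | succ n ih =>
    obtain ⟨h2, c', hc', hdc⟩ := hc
    exact ⟨h2.mul hm, _, ih hc', fun k t ht => (hdc k t ht).const_mul (m k)⟩

theorem sum {ι : Type*} (s : Finset ι) {c : ι → (Fin d → ℤ) → ℝ → ℂ}
    (hc : ∀ i, SmoothCoeff T n (c i)) : SmoothCoeff T n (fun k t => ∑ i ∈ s, c i k t) := by
  classical
  induction s using Finset.induction_on with
  | empty => simpa using zero
  | insert i s hi ih =>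
    simp only [Finset.sum_insert hi]
    exact (hc i).add ih

theorem conv (ha : SmoothCoeff T n a) (hc : SmoothCoeff T n c) :
    SmoothCoeff T n (fun k t => conv (fun j => a j t) (fun j => c j t) k) := by
  induction n generalizing a c with
  | zero => exact IsCoeff.conv ha hc
  | succ n ih =>
    have hap := ha.pred
    have hcp := hc.pred
    obtain ⟨h1, a', ha', hda⟩ := ha
    obtain ⟨h2, c', hc', hdc⟩ := hc
    exact ⟨h1.conv h2, _, (ih ha' hcp).add (ih hap hc'), fun k t ht =>
      hasDerivWithinAt_conv h1 ha'.isCoeff h2 hc'.isCoeff hda hdc k ht⟩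

end SmoothCoeff

/-- A solution of a semilinear system on the Fourier side is smooth in time. -/
theorem smoothCoeff_of_hasDerivWithinAt {ι : Type*} [Fintype ι] {r : ι → (Fin d → ℤ) → ℝ}
    {m : ι → ι → ι → (Fin d → ℤ) → ℂ} (hr : ∀ α, PolyBdd fun k => (r α k : ℂ))
    (hm : ∀ α β γ, PolyBdd (m α β γ)) {c : ι → (Fin d → ℤ) → ℝ → ℂ} (hc : ∀ α, IsCoeff T (c α))
    (hd : ∀ α k, ∀ t ∈ Icc (0 : ℝ) T, HasDerivWithinAt (c α k)
      (-r α k * c α k t + quadTerm m (fun β k => c β k t) (fun β k => c β k t) α k)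
      (Icc 0 T) t) (n : ℕ) (α : ι) : SmoothCoeff T n (c α) := by
  induction n generalizing α with
  | zero => exact hc α
  | succ n ih =>
    have hr' : PolyBdd fun k => -(r α k : ℂ) := by simpa [PolyBdd] using hr α
    exact ⟨hc α, _, ((ih α).mul hr').add (SmoothCoeff.sum _ fun β => SmoothCoeff.sum _ fun γ =>
      ((ih β).conv (ih γ)).mul (hm α β γ)), fun k t ht => hd α k t ht⟩

end

section Synthesis

variable {d : ℕ}

/-- The character `x ↦ e^{2πi k·x}`. -/
def mode (k : Fin d → ℤ) (x : Fin d → ℝ) : ℂ :=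
  Complex.exp (2 * π * Complex.I * ∑ j, (k j : ℂ) * (x j : ℂ))

/-- The symbol of `∂_j`. -/
def symb (j : Fin d) (k : Fin d → ℤ) : ℂ := 2 * π * Complex.I * k j

/-- The sum of a Fourier series. -/
def synth (a : (Fin d → ℤ) → ℂ) (x : Fin d → ℝ) : ℂ := ∑' k, a k * mode k x

theorem norm_mode (k : Fin d → ℤ) (x : Fin d → ℝ) : ‖mode k x‖ = 1 := by
  have : 2 * π * Complex.I * ∑ j, (k j : ℂ) * (x j : ℂ) =
      ((2 * π * ∑ j, (k j : ℝ) * x j : ℝ) : ℂ) * Complex.I := by push_cast; ring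
  rw [mode, this, Complex.norm_exp_ofReal_mul_I]

theorem mode_add (k l : Fin d → ℤ) (x : Fin d → ℝ) : mode (k + l) x = mode k x * mode l x := by
  rw [mode, mode, mode, ← Complex.exp_add, ← mul_add, ← Finset.sum_add_distrib]
  simp [add_mul]

theorem mode_neg (k : Fin d → ℤ) (x : Fin d → ℝ) : mode (-k) x = star (mode k x) := by
  rw [mode, mode, RCLike.star_def, ← Complex.exp_conj]
  have : (starRingEnd ℂ) 2 = 2 := map_ofNat _ 2
  simp [this]

theorem mode_add_single (k : Fin d → ℤ) (x : Fin d → ℝ) (i : Fin d) :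
    mode k (x + Pi.single i 1) = mode k x := by
  have : 2 * π * Complex.I * ∑ j, (k j : ℂ) * ((x + Pi.single i (1 : ℝ) : Fin d → ℝ) j : ℝ) =
      2 * π * Complex.I * ∑ j, (k j : ℂ) * (x j : ℂ) + k i * (2 * π * Complex.I) := by
    have h : ∑ j, (k j : ℂ) * ((Pi.single i (1 : ℝ) : Fin d → ℝ) j : ℂ) = k i := by
      rw [Finset.sum_eq_single i (fun j _ hj => by rw [Pi.single_eq_of_ne hj]; simp) (by simp)]
      simp
    simp only [Pi.add_apply, Complex.ofReal_add, mul_add, Finset.sum_add_distrib, h]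
    ring
  rw [mode, mode, this, Complex.exp_add, Complex.exp_int_mul_two_pi_mul_I, mul_one]

theorem polyBdd_symb (j : Fin d) : PolyBdd (symb j) := by
  refine ⟨2 * π, 1, by positivity, fun k => ?_⟩
  have h : ‖(k j : ℂ)‖ ≤ 1 + ‖k‖ := by
    have := norm_le_pi_norm k j
    rw [Complex.norm_intCast, ← Int.norm_eq_abs]
    linarith
  have : ‖symb j k‖ = 2 * π * ‖(k j : ℂ)‖ := by
    simp [symb, abs_of_pos Real.pi_pos]
  rw [this, pow_one]
  gcongr

section FixedTime

variable {a c : (Fin d → ℤ) → ℂ}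

theorem summable_mul_mode (ha : RapidDecay fun k => ‖a k‖) (x : Fin d → ℝ) :
    Summable fun k => a k * mode k x :=
  .of_norm (by simpa [norm_mode] using ha.summable)

theorem RapidDecay.multiplier (ha : RapidDecay fun k => ‖a k‖) {m : (Fin d → ℤ) → ℂ}
    (hm : PolyBdd m) : RapidDecay fun k => ‖m k * a k‖ := by
  obtain ⟨C, n, hC, hm⟩ := hm
  refine (ha.poly_mul hC n).mono (fun _ => norm_nonneg _) fun k => ?_
  rw [norm_mul]
  exact mul_le_mul_of_nonneg_right (hm k) (norm_nonneg _)

theorem RapidDecay.norm_add (ha : RapidDecay fun k => ‖a k‖)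
    (hc : RapidDecay fun k => ‖c k‖) :
    RapidDecay fun k => ‖a k + c k‖ :=
  (ha.add hc).mono (fun _ => norm_nonneg _) fun _ => norm_add_le _ _

theorem RapidDecay.norm_sub (ha : RapidDecay fun k => ‖a k‖)
    (hc : RapidDecay fun k => ‖c k‖) :
    RapidDecay fun k => ‖a k - c k‖ :=
  (ha.add hc).mono (fun _ => norm_nonneg _) fun _ => norm_sub_le _ _

theorem RapidDecay.norm_conv (ha : RapidDecay fun k => ‖a k‖)
    (hc : RapidDecay fun k => ‖c k‖) :
    RapidDecay fun k => ‖_root_.conv a c k‖ :=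
  (RapidDecay.conv ha hc).mono (fun _ => norm_nonneg _) fun k => norm_conv_le ha.summable
    hc.summable k

theorem synth_add (ha : RapidDecay fun k => ‖a k‖)
    (hc : RapidDecay fun k => ‖c k‖) (x : Fin d → ℝ) :
    synth (fun k => a k + c k) x = synth a x + synth c x := by
  simp only [synth, add_mul]
  exact (summable_mul_mode ha x).tsum_add (summable_mul_mode hc x)

theorem synth_sub (ha : RapidDecay fun k => ‖a k‖)
    (hc : RapidDecay fun k => ‖c k‖) (x : Fin d → ℝ) :
    synth (fun k => a k - c k) x = synth a x - synth c x := by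
  simp only [synth, sub_mul]
  exact (summable_mul_mode ha x).tsum_sub (summable_mul_mode hc x)

theorem synth_conv (ha : RapidDecay fun k => ‖a k‖)
    (hc : RapidDecay fun k => ‖c k‖) (x : Fin d → ℝ) :
    synth (conv a c) x = synth a x * synth c x := by
  have h : ∀ {a : (Fin d → ℤ) → ℂ}, RapidDecay (fun k => ‖a k‖) →
      Summable fun k => ‖a k * mode k x‖ := fun ha => by
    simpa [norm_mode] using ha.summable
  rw [synth, synth, synth, ← (hasSum_conv (h ha) (h hc)).tsum_eq]
  refine tsum_congr fun k => ?_
  rw [conv, ← tsum_mul_right]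
  refine tsum_congr fun j => ?_
  have : mode k x = mode j x * mode (k - j) x := by rw [← mode_add, add_sub_cancel]
  rw [this]
  ring

theorem symb_mul_conv (ha : RapidDecay fun k => ‖a k‖)
    (hc : RapidDecay fun k => ‖c k‖) (j : Fin d) (k : Fin d → ℤ) :
    symb j k * conv a c k =
    conv (fun k => symb j k * a k) c k + conv a (fun k => symb j k * c k) k := by
  have hja := RapidDecay.multiplier ha (polyBdd_symb j)
  have hjc := RapidDecay.multiplier hc (polyBdd_symb j)
  rw [conv, conv, conv, ← tsum_mul_left, ← Summable.tsum_add
    (summable_conv_term hja.summable hc.summable k)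
    (summable_conv_term ha.summable hjc.summable k)]
  refine tsum_congr fun l => ?_
  simp only [symb, Pi.sub_apply, Int.cast_sub]
  ring

end FixedTime

theorem conv_comm (a c : (Fin d → ℤ) → ℂ) : conv a c = conv c a := by
  funext k
  rw [conv, conv, ← (Equiv.subLeft k).tsum_eq]
  simp [mul_comm]

theorem synth_const_mul (z : ℂ) (a : (Fin d → ℤ) → ℂ) (x : Fin d → ℝ) :
    synth (fun k => z * a k) x = z * synth a x := by
  simp only [synth, mul_assoc]
  exact tsum_mul_left

theorem synth_sum {ι : Type*} (s : Finset ι) {a : ι → (Fin d → ℤ) → ℂ}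
    (ha : ∀ i, RapidDecay fun k => ‖a i k‖) (x : Fin d → ℝ) :
    synth (fun k => ∑ i ∈ s, a i k) x = ∑ i ∈ s, synth (a i) x := by
  simp only [synth, Finset.sum_mul]
  exact Summable.tsum_finsetSum fun i _ => summable_mul_mode (ha i) x

theorem star_synth {a : (Fin d → ℤ) → ℂ} (ha : ∀ k, a (-k) = star (a k)) (x : Fin d → ℝ) :
    star (synth a x) = synth a x := by
  rw [synth, tsum_star, ← (Equiv.neg _).tsum_eq]
  refine tsum_congr fun k => ?_
  rw [Equiv.neg_apply, star_mul', ha, mode_neg, star_star, star_star]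

theorem synth_add_single (a : (Fin d → ℤ) → ℂ) (x : Fin d → ℝ) (i : Fin d) :
    synth a (x + Pi.single i 1) = synth a x := by
  simp only [synth, mode_add_single]

/-- The functional `(s, y) ↦ y_j` on space-time. -/
def spaceProj (j : Fin d) : ℝ × (Fin d → ℝ) →L[ℝ] ℝ :=
  (ContinuousLinearMap.proj j).comp (ContinuousLinearMap.snd ℝ ℝ (Fin d → ℝ))

/-- The vector-valued linear form on space-time with components `v` in time, `w j` in space. -/
def spaceTimeForm (v : ℂ) (w : Fin d → ℂ) : ℝ × (Fin d → ℝ) →L[ℝ] ℂ :=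
  ContinuousLinearMap.smulRightL ℝ _ ℂ (ContinuousLinearMap.fst ℝ ℝ (Fin d → ℝ)) v +
    ∑ j, ContinuousLinearMap.smulRightL ℝ _ ℂ (spaceProj j) (w j)

theorem spaceTimeForm_apply (v : ℂ) (w : Fin d → ℂ) (p : ℝ × (Fin d → ℝ)) :
    spaceTimeForm v w p = p.1 • v + ∑ j, p.2 j • w j := by
  simp [spaceTimeForm, spaceProj]

theorem norm_spaceTimeForm_le (v : ℂ) (w : Fin d → ℂ) :
    ‖spaceTimeForm v w‖ ≤ ‖v‖ + ∑ j, ‖w j‖ := by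
  refine ContinuousLinearMap.opNorm_le_bound _ (by positivity) fun p => ?_
  rw [spaceTimeForm_apply, add_mul, Finset.sum_mul]
  refine (norm_add_le _ _).trans (add_le_add ?_ ((norm_sum_le _ _).trans
    (Finset.sum_le_sum fun j _ => ?_))) <;> rw [norm_smul, mul_comm]
  · exact mul_le_mul_of_nonneg_left (norm_fst_le p) (norm_nonneg _)
  · exact mul_le_mul_of_nonneg_left ((norm_le_pi_norm p.2 j).trans (norm_snd_le p)) (norm_nonneg _)

theorem hasSum_spaceTimeForm {I : Type*} {v : I → ℂ} {w : Fin d → I → ℂ} (hv : Summable v)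
    (hw : ∀ j, Summable (w j)) :
    HasSum (fun i => spaceTimeForm (v i) fun j => w j i)
      (spaceTimeForm (∑' i, v i) fun j => ∑' i, w j i) :=
  (hv.hasSum.mapL _).add (hasSum_sum fun j _ => (hw j).hasSum.mapL _)

theorem hasFDerivAt_mode (k : Fin d → ℤ) (x : Fin d → ℝ) :
    HasFDerivAt (mode k) (∑ j, (ContinuousLinearMap.proj (R := ℝ) (φ := fun _ : Fin d => ℝ) j).smulRight
      (symb j k * mode k x)) x := by
  have h1 : ∀ j ∈ Finset.univ, HasFDerivAt (fun x : Fin d → ℝ => (k j : ℂ) * (x j : ℂ))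
      ((ContinuousLinearMap.proj (R := ℝ) (φ := fun _ : Fin d => ℝ) j).smulRight (k j : ℂ)) x := by
    intro j _
    have := ((ContinuousLinearMap.proj (R := ℝ) (φ := fun _ : Fin d => ℝ) j).smulRight
      (k j : ℂ)).hasFDerivAt (x := x)
    refine this.congr_of_eventuallyEq (.of_forall fun y => ?_)
    simp [mul_comm]
  have h := ((HasFDerivAt.fun_sum h1).const_mul (2 * π * Complex.I)).cexp
  refine h.congr_fderiv ?_
  ext y
  simp [symb, mode, Finset.mul_sum]
  refine Finset.sum_congr rfl fun j _ => ?_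
  ring

variable {T : ℝ}

theorem hasFDerivWithinAt_synth {c c' : (Fin d → ℤ) → ℝ → ℂ} (hc : IsCoeff T c)
    (hc' : IsCoeff T c')
    (hd : ∀ k, ∀ t ∈ Icc (0 : ℝ) T, HasDerivWithinAt (c k) (c' k t) (Icc 0 T) t)
    {p : ℝ × (Fin d → ℝ)} (hp : p ∈ Icc 0 T ×ˢ (univ : Set (Fin d → ℝ))) :
    HasFDerivWithinAt (fun p : ℝ × (Fin d → ℝ) => synth (fun k => c k p.1) p.2)
      (spaceTimeForm (synth (fun k => c' k p.1) p.2)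
        fun j => synth (fun k => symb j k * c k p.1) p.2) (Icc 0 T ×ˢ univ) p := by
  have hL := hasSum_spaceTimeForm (summable_mul_mode (hc'.rapidDecay hp.1) p.2)
    fun j => summable_mul_mode ((hc.mul (polyBdd_symb j)).rapidDecay hp.1) p.2
  have hsum : ∀ q ∈ Icc 0 T ×ˢ (univ : Set (Fin d → ℝ)), Summable fun k => c k q.1 * mode k q.2 :=
    fun q hq => summable_mul_mode (hc.rapidDecay hq.1) q.2
  have hcs := fun j => hc.mul (polyBdd_symb j)
  choose _ N hN hcN using hcs
  obtain ⟨-, M', hM', hcM'⟩ := hc'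
  refine hasFDerivWithinAt_tsum_of_convex ((convex_Icc 0 T).prod convex_univ)
    (f := fun k (p : ℝ × (Fin d → ℝ)) => c k p.1 * mode k p.2)
    (f' := fun k p => spaceTimeForm (c' k p.1 * mode k p.2)
      fun j => symb j k * c k p.1 * mode k p.2)
    (hM'.add (RapidDecay.sum Finset.univ fun j _ => hN j)).summable (fun k q hq => ?_)
    (fun k q hq => ?_) hsum hp hL
  · have h1 := (hd k q.1 hq.1).hasFDerivWithinAt.comp q
      (hasFDerivWithinAt_fst (s := Icc 0 T ×ˢ univ)) (fun _ h => h.1)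
    have h2 := (hasFDerivAt_mode k q.2).comp_hasFDerivWithinAt q
      (hasFDerivWithinAt_snd (s := Icc 0 T ×ˢ univ))
    refine (h1.mul h2).congr_fderiv ?_
    ext v
    all_goals simp [spaceTimeForm_apply, Finset.mul_sum]
    · ring
    · refine Finset.sum_congr rfl fun j _ => ?_
      ring
  · refine (norm_spaceTimeForm_le _ _).trans (add_le_add ?_ (Finset.sum_le_sum fun j _ => ?_)) <;>
      rw [norm_mul, norm_mode, mul_one]
    · exact hcM' k _ hq.1
    · exact hcN j k _ hq.1

theorem contDiffOn_synth (hT : 0 < T) {n : ℕ} {c : (Fin d → ℤ) → ℝ → ℂ} (hc : SmoothCoeff T n c) :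
    ContDiffOn ℝ n (fun p : ℝ × (Fin d → ℝ) => synth (fun k => c k p.1) p.2)
      (Icc 0 T ×ˢ univ) := by
  induction n generalizing c with
  | zero =>
    obtain ⟨h0, M, hM, hcM⟩ := hc
    refine contDiffOn_zero.2 (continuousOn_tsum (fun k => ?_) hM.summable fun k p hp => ?_)
    · have : Continuous (mode k) :=
        continuous_iff_continuousAt.2 fun x => (hasFDerivAt_mode k x).continuousAt
      exact ((h0 k).comp continuousOn_fst fun _ h => h.1).mul
        (this.comp continuous_snd).continuousOn
    · rw [norm_mul, norm_mode, mul_one]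
      exact hcM k _ hp.1
  | succ n ih =>
    have hcp := hc.pred
    obtain ⟨h0, c', hc', hd⟩ := hc
    push_cast
    rw [contDiffOn_succ_iff_hasFDerivWithinAt_of_uniqueDiffOn
      ((uniqueDiffOn_Icc hT).prod uniqueDiffOn_univ)]
    refine ⟨by simp, _, ?_, fun p hp => hasFDerivWithinAt_synth h0 hc'.isCoeff hd hp⟩
    exact ((ContinuousLinearMap.contDiff _).comp_contDiffOn (ih hc')).add
      (ContDiffOn.sum fun j _ => (ContinuousLinearMap.contDiff _).comp_contDiffOn
        (ih (hcp.mul (polyBdd_symb j))))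

end Synthesis

section RealFields

variable {d : ℕ}

theorem isCoeff_const {a : (Fin d → ℤ) → ℂ} (ha : RapidDecay fun k => ‖a k‖) (T : ℝ) :
    IsCoeff T fun k _ => a k :=
  ⟨fun _ => continuousOn_const, _, ha, fun _ _ _ => le_rfl⟩

theorem hasFDerivAt_synth {a : (Fin d → ℤ) → ℂ} (ha : RapidDecay fun k => ‖a k‖) (x : Fin d → ℝ) :
    HasFDerivAt (synth a) ((spaceTimeForm 0 fun j => synth (fun k => symb j k * a k) x).comp
      (ContinuousLinearMap.inr ℝ ℝ (Fin d → ℝ))) x := by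
  have h := hasFDerivWithinAt_synth (T := 1) (isCoeff_const ha 1) IsCoeff.zero
    (fun k t _ => hasDerivWithinAt_const t _ (a k)) (p := (0, x)) (by simp)
  have h2 := h.comp_hasFDerivAt (f := fun y => ((0 : ℝ), y)) x (hasFDerivAt_prodMk_right 0 x)
    (.of_forall fun y => by simp)
  refine h2.congr_fderiv ?_
  simp [synth]

theorem hasDerivAt_re_synth {a : (Fin d → ℤ) → ℂ} (ha : RapidDecay fun k => ‖a k‖)
    (x v : Fin d → ℝ) : fderiv ℝ (fun x => (synth a x).re) x v =
      ∑ j, v j * (synth (fun k => symb j k * a k) x).re := by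
  have h := Complex.reCLM.hasFDerivAt.comp x (hasFDerivAt_synth ha x)
  have h2 : HasFDerivAt (fun x => (synth a x).re) _ x := h
  rw [h2.fderiv]
  simp [spaceTimeForm_apply]

theorem pd_re_synth {a : (Fin d → ℤ) → ℂ} (ha : RapidDecay fun k => ‖a k‖) (j : Fin d) :
    pd j (fun x => (synth a x).re) = fun x => (synth (fun k => symb j k * a k) x).re := by
  funext x
  rw [pd, hasDerivAt_re_synth ha, Finset.sum_eq_single j]
  · simp
  · intro i _ hi
    simp [Pi.single_eq_of_ne hi]
  · simp

theorem hasDerivWithinAt_re_synth {T : ℝ} {c c' : (Fin d → ℤ) → ℝ → ℂ} (hc : IsCoeff T c)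
    (hc' : IsCoeff T c')
    (hd : ∀ k, ∀ t ∈ Icc (0 : ℝ) T, HasDerivWithinAt (c k) (c' k t) (Icc 0 T) t)
    {t : ℝ} (ht : t ∈ Icc 0 T) (x : Fin d → ℝ) :
    HasDerivWithinAt (fun s => (synth (fun k => c k s) x).re) (synth (fun k => c' k t) x).re
      (Icc 0 T) t := by
  have h := hasFDerivWithinAt_synth hc hc' hd (p := (t, x)) (by simpa using ht)
  have h2 := h.comp (f := fun s => (s, x)) t (hasFDerivAt_prodMk_left t x).hasFDerivWithinAt
    (s := Icc 0 T) fun y hy => by simpa using hy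
  have h3 := (Complex.reCLM.hasFDerivAt.comp_hasFDerivWithinAt t h2).hasDerivWithinAt
  refine HasDerivWithinAt.congr_deriv h3 ?_
  simp [spaceTimeForm_apply]

end RealFields

section FourierCoefficients

variable {d : ℕ}

/-- The normalized Haar measure of the torus. -/
def torusMeasure (d : ℕ) : Measure (Fin d → UnitAddCircle) :=
  Measure.pi fun _ => AddCircle.haarAddCircle

instance : (torusMeasure d).IsAddHaarMeasure :=
  inferInstanceAs (Measure.pi fun _ => AddCircle.haarAddCircle).IsAddHaarMeasure

instance : IsProbabilityMeasure (torusMeasure d) :=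
  inferInstanceAs (IsProbabilityMeasure (Measure.pi fun _ => AddCircle.haarAddCircle))

/-- A section of the projection onto the torus. -/
def torusLift (t : Fin d → UnitAddCircle) : Fin d → ℝ := fun i => (t i).out

theorem torusProj_torusLift (t : Fin d → UnitAddCircle) : torusProj d 1 (torusLift t) = t := by
  funext i
  exact QuotientAddGroup.out_eq' _

theorem torusProj_add (x y : Fin d → ℝ) :
    torusProj d 1 (x + y) = torusProj d 1 x + torusProj d 1 y := by
  funext i
  simp [torusProj]

theorem isOpenQuotientMap_torusProj : IsOpenQuotientMap (torusProj d 1) :=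
  IsOpenQuotientMap.piMap fun _ => QuotientAddGroup.isOpenQuotientMap_mk

variable {E : Type*} {w : (Fin d → ℝ) → E}

theorem Prdc.periodic_intCast (hw : Prdc 1 w) (n : Fin d → ℤ) :
    Function.Periodic w fun i => (n i : ℝ) := by
  have h : ∀ s : Finset (Fin d),
      Function.Periodic w (∑ i ∈ s, n i • (Pi.single i (1 : ℝ) : Fin d → ℝ)) := by
    intro s
    induction s using Finset.induction_on with
    | empty => intro x; simp
    | insert i s hi ih =>
      rw [Finset.sum_insert hi]
      exact Function.Periodic.add_period (Function.Periodic.zsmul (fun x => hw x i) _) ih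
  convert h Finset.univ using 1
  funext i
  simp [Finset.sum_apply, Pi.single_apply]

theorem Prdc.eq_of_torusProj_eq (hw : Prdc 1 w) {x y : Fin d → ℝ}
    (h : torusProj d 1 x = torusProj d 1 y) : w x = w y := by
  have h1 : ∀ i, ∃ n : ℤ, x i = y i + n := fun i => by
    have h2 : ((y i : ℝ) : AddCircle (1 : ℝ)) = (x i : ℝ) := (congrFun h i).symm
    obtain ⟨n, hn⟩ := AddSubgroup.mem_zmultiples_iff.1 (QuotientAddGroup.eq.1 h2)
    refine ⟨n, ?_⟩
    rw [zsmul_one] at hn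
    linarith
  choose n hn using h1
  rw [show x = y + fun i => (n i : ℝ) from funext hn, hw.periodic_intCast n]

theorem Prdc.torusLift_torusProj (hw : Prdc 1 w) (x : Fin d → ℝ) :
    w (torusLift (torusProj d 1 x)) = w x :=
  hw.eq_of_torusProj_eq (torusProj_torusLift _)

theorem Prdc.torusLift_add (hw : Prdc 1 w) (t : Fin d → UnitAddCircle) (x : Fin d → ℝ) :
    w (torusLift (t + torusProj d 1 x)) = w (torusLift t + x) :=
  hw.eq_of_torusProj_eq (by rw [torusProj_torusLift, torusProj_add, torusProj_torusLift])

theorem Prdc.continuous_torusLift [TopologicalSpace E] (hw : Prdc 1 w) (h : Continuous w) :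
    Continuous fun t => w (torusLift t) := by
  rw [isOpenQuotientMap_torusProj.isQuotientMap.continuous_iff]
  simpa [Function.comp_def, hw.torusLift_torusProj] using h

theorem Prdc.exists_norm_le [SeminormedAddCommGroup E] (hw : Prdc 1 w) (h : Continuous w) :
    ∃ C, 0 ≤ C ∧ ∀ x, ‖w x‖ ≤ C := by
  obtain ⟨C, hC⟩ := (isCompact_range (hw.continuous_torusLift h)).isBounded.exists_norm_le
  refine ⟨C, (norm_nonneg _).trans (hC _ ⟨0, rfl⟩), fun x => hC _ ⟨torusProj d 1 x, ?_⟩⟩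
  exact hw.torusLift_torusProj x

theorem Prdc.pd {g : (Fin d → ℝ) → ℝ} (hg : Prdc 1 g) (j : Fin d) : Prdc 1 (pd j g) := by
  intro x i
  have h : (fun x => g (x + Pi.single i 1)) = g := funext fun x => hg x i
  rw [_root_.pd, ← fderiv_comp_add_right, h, _root_.pd]

theorem contDiff_pd {g : (Fin d → ℝ) → ℝ} (hg : ContDiff ℝ (⊤ : ℕ∞) g) (j : Fin d) :
    ContDiff ℝ (⊤ : ℕ∞) (pd j g) :=
  (hg.fderiv_right (m := (⊤ : ℕ∞)) (by simp)).clm_apply contDiff_const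

/-- Fourier coefficients of a real function, read through the section `torusLift`. -/
def fcoeff (g : (Fin d → ℝ) → ℝ) (k : Fin d → ℤ) : ℂ :=
  ∫ t, UnitAddTorus.mFourier (-k) t * (g (torusLift t) : ℂ) ∂torusMeasure d

theorem mFourier_torusProj (k : Fin d → ℤ) (x : Fin d → ℝ) :
    UnitAddTorus.mFourier k (torusProj d 1 x) = mode k x := by
  rw [mode, Finset.mul_sum, Complex.exp_sum]
  change ∏ i, fourier (k i) ((x i : ℝ) : AddCircle (1 : ℝ)) = _
  refine Finset.prod_congr rfl fun i _ => ?_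
  rw [fourier_coe_apply]
  congr 1
  push_cast
  ring

theorem norm_mFourier_apply (k : Fin d → ℤ) (t : Fin d → UnitAddCircle) :
    ‖UnitAddTorus.mFourier k t‖ = 1 := by
  rw [← torusProj_torusLift t, mFourier_torusProj, norm_mode]

theorem fcoeff_neg (g : (Fin d → ℝ) → ℝ) (k : Fin d → ℤ) :
    fcoeff g (-k) = star (fcoeff g k) := by
  rw [fcoeff, fcoeff, RCLike.star_def, ← integral_conj]
  refine integral_congr_ae (.of_forall fun t => ?_)
  simp [UnitAddTorus.mFourier_neg]

theorem norm_fcoeff_le {g : (Fin d → ℝ) → ℝ} {C : ℝ} (h : ∀ x, ‖g x‖ ≤ C) (k : Fin d → ℤ) :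
    ‖fcoeff g k‖ ≤ C := by
  have := norm_integral_le_of_norm_le_const (μ := torusMeasure d) (C := C)
    (f := fun t => UnitAddTorus.mFourier (-k) t * (g (torusLift t) : ℂ))
    (.of_forall fun t => by
      rw [norm_mul, norm_mFourier_apply, one_mul, Complex.norm_real]
      exact h _)
  rw [probReal_univ, mul_one] at this
  exact this

theorem continuous_fcoeff_integrand {g : (Fin d → ℝ) → ℝ} (hg : Prdc 1 g) (h : Continuous g)
    (k : Fin d → ℤ) :
    Continuous fun t => UnitAddTorus.mFourier (-k) t * (g (torusLift t) : ℂ) :=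
  (UnitAddTorus.mFourier (-k)).continuous.mul
    (Complex.continuous_ofReal.comp (hg.continuous_torusLift h))

theorem Prdc.comp_add {g : (Fin d → ℝ) → ℝ} (hg : Prdc 1 g) (y : Fin d → ℝ) :
    Prdc 1 fun x => g (x + y) := fun x i => by
  beta_reduce
  rw [add_right_comm, hg]

theorem mode_add_right (k : Fin d → ℤ) (x y : Fin d → ℝ) :
    mode k (x + y) = mode k x * mode k y := by
  rw [mode, mode, mode, ← Complex.exp_add, ← mul_add, ← Finset.sum_add_distrib]
  simp [mul_add]

theorem fcoeff_translate {g : (Fin d → ℝ) → ℝ} (hg : Prdc 1 g) (y : Fin d → ℝ) (k : Fin d → ℤ) :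
    fcoeff (fun x => g (x + y)) k = mode k y * fcoeff g k := by
  have h1 : fcoeff g k = ∫ t, UnitAddTorus.mFourier (-k) (t + torusProj d 1 y) *
      (g (torusLift (t + torusProj d 1 y)) : ℂ) ∂torusMeasure d :=
    (integral_add_right_eq_self
      (fun t => UnitAddTorus.mFourier (-k) t * (g (torusLift t) : ℂ)) _).symm
  rw [h1, fcoeff, ← integral_const_mul]
  refine integral_congr_ae (.of_forall fun t => ?_)
  beta_reduce
  rw [hg.torusLift_add]
  obtain ⟨z, rfl⟩ : ∃ z, torusProj d 1 z = t := ⟨_, torusProj_torusLift t⟩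
  have h2 : mode k y * mode (-k) y = 1 := by rw [← mode_add, add_neg_cancel]; simp [mode]
  rw [← torusProj_add, mFourier_torusProj, mFourier_torusProj, mode_add_right]
  linear_combination (-mode (-k) z * (g (torusLift (torusProj d 1 z) + y) : ℂ)) * h2

theorem hasDerivAt_integral_of_norm_le {α : Type*} [MeasurableSpace α] {μ : Measure α}
    [IsFiniteMeasure μ] {F F' : ℝ → α → ℂ} {C x₀ : ℝ} (hF : ∀ s, AEStronglyMeasurable (F s) μ)
    (hInt : Integrable (F x₀) μ) (hF' : AEStronglyMeasurable (F' x₀) μ)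
    (hb : ∀ a s, ‖F' s a‖ ≤ C) (hd : ∀ a s, HasDerivAt (fun s => F s a) (F' s a) s) :
    HasDerivAt (fun s => ∫ a, F s a ∂μ) (∫ a, F' x₀ a ∂μ) x₀ :=
  (hasDerivAt_integral_of_dominated_loc_of_deriv_le (s := univ) (bound := fun _ => C) univ_mem
    (.of_forall hF) hInt hF' (.of_forall fun a s _ => hb a s) (integrable_const _)
    (.of_forall fun a s _ => hd a s)).2

theorem fcoeff_pd {g : (Fin d → ℝ) → ℝ} (hg : Prdc 1 g) (h : ContDiff ℝ (⊤ : ℕ∞) g) (j : Fin d)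
    (k : Fin d → ℤ) : fcoeff (pd j g) k = symb j k * fcoeff g k := by
  obtain ⟨C, hC, hgC⟩ := (hg.pd j).exists_norm_le (contDiff_pd h j).continuous
  have hline : ∀ (x : Fin d → ℝ) (s : ℝ), HasDerivAt (fun s : ℝ => x + s • Pi.single j (1 : ℝ))
      (Pi.single j 1) s := fun x s => by
    simpa using ((hasDerivAt_id s).smul_const (Pi.single j (1 : ℝ) : Fin d → ℝ)).const_add x
  have hdiff : ∀ (x : Fin d → ℝ) (s : ℝ), HasDerivAt (fun s : ℝ => g (x + s • Pi.single j (1 : ℝ)))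
      (pd j g (x + s • Pi.single j 1)) s := fun x s =>
    ((h.differentiable (by simp)) _).hasFDerivAt.comp_hasDerivAt s (hline x s)
  have hcont : ∀ {f : (Fin d → ℝ) → ℝ} (_ : Prdc 1 f) (_ : Continuous f) (y : Fin d → ℝ),
      Continuous fun t => UnitAddTorus.mFourier (-k) t * (f (torusLift t + y) : ℂ) :=
    fun hf hfc y => continuous_fcoeff_integrand (hf.comp_add y)
      (hfc.comp (continuous_id.add continuous_const)) k
  have h1 : HasDerivAt (fun s : ℝ => fcoeff (fun x => g (x + s • Pi.single j (1 : ℝ))) k)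
      (fcoeff (fun x => pd j g (x + (0 : ℝ) • Pi.single j (1 : ℝ))) k) 0 := by
    have hmeas : ∀ s : ℝ, AEStronglyMeasurable (fun t => UnitAddTorus.mFourier (-k) t *
        (g (torusLift t + s • Pi.single j (1 : ℝ)) : ℂ)) (torusMeasure d) := fun s =>
      (hcont hg h.continuous _).aestronglyMeasurable
    have hmeas' : AEStronglyMeasurable (fun t => UnitAddTorus.mFourier (-k) t *
        (pd j g (torusLift t + (0 : ℝ) • Pi.single j (1 : ℝ)) : ℂ)) (torusMeasure d) :=
      (hcont (hg.pd j) (contDiff_pd h j).continuous _).aestronglyMeasurable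
    have hInt : Integrable (fun t => UnitAddTorus.mFourier (-k) t *
        (g (torusLift t + (0 : ℝ) • Pi.single j (1 : ℝ)) : ℂ)) (torusMeasure d) :=
      (hcont hg h.continuous _).integrable_of_hasCompactSupport (HasCompactSupport.of_compactSpace _)
    have hb : ∀ (t : Fin d → UnitAddCircle) (s : ℝ), ‖UnitAddTorus.mFourier (-k) t *
        (pd j g (torusLift t + s • Pi.single j (1 : ℝ)) : ℂ)‖ ≤ C := fun t s => by
      rw [norm_mul, norm_mFourier_apply, one_mul, Complex.norm_real]
      exact hgC _
    have hd : ∀ (t : Fin d → UnitAddCircle) (s : ℝ), HasDerivAt (fun s => UnitAddTorus.mFourier (-k) t *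
        (g (torusLift t + s • Pi.single j (1 : ℝ)) : ℂ)) (UnitAddTorus.mFourier (-k) t *
        (pd j g (torusLift t + s • Pi.single j (1 : ℝ)) : ℂ)) s := fun t s =>
      ((hdiff (torusLift t) s).ofReal_comp).const_mul _
    exact hasDerivAt_integral_of_norm_le hmeas hInt hmeas' hb hd
  have h2 : HasDerivAt (fun s : ℝ => mode k (s • Pi.single j (1 : ℝ)) * fcoeff g k)
      (symb j k * fcoeff g k) 0 := by
    have hm : (fun s : ℝ => mode k (s • Pi.single j (1 : ℝ))) =
        fun s : ℝ => Complex.exp (symb j k * s) := by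
      funext s
      rw [mode, Finset.sum_eq_single j (fun i _ hi => by simp [Pi.single_eq_of_ne hi]) (by simp)]
      simp [symb]
      ring_nf
    have h3 : HasDerivAt (fun s : ℝ => Complex.exp (symb j k * s)) (symb j k) 0 := by
      simpa using ((Complex.ofRealCLM.hasDerivAt (x := 0)).const_mul (symb j k)).cexp
    rw [← hm] at h3
    exact h3.mul_const _
  simp only [fcoeff_translate hg, zero_smul, add_zero] at h1
  exact h1.unique h2

theorem fcoeff_sum {ι : Type*} (s : Finset ι) {g : ι → (Fin d → ℝ) → ℝ} (hg : ∀ i, Prdc 1 (g i))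
    (h : ∀ i, Continuous (g i)) (k : Fin d → ℤ) :
    fcoeff (fun x => ∑ i ∈ s, g i x) k = ∑ i ∈ s, fcoeff (g i) k := by
  simp only [fcoeff, Complex.ofReal_sum, Finset.mul_sum]
  exact integral_finsetSum _ fun i _ => (continuous_fcoeff_integrand (hg i) (h i)
    k).integrable_of_hasCompactSupport (HasCompactSupport.of_compactSpace _)

theorem rapidDecay_fcoeff {g : (Fin d → ℝ) → ℝ} (hg : Prdc 1 g) (h : ContDiff ℝ (⊤ : ℕ∞) g) :
    RapidDecay fun k => ‖fcoeff g k‖ := by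
  refine .of_bounded (fun _ => norm_nonneg _) fun n => ?_
  induction n generalizing g with
  | zero =>
    obtain ⟨C, -, hC⟩ := hg.exists_norm_le h.continuous
    exact ⟨C, fun k => by simpa using norm_fcoeff_le hC k⟩
  | succ n ih =>
    obtain ⟨C, hC⟩ := ih hg h
    choose D hD using fun j => ih (hg.pd j) (contDiff_pd h j)
    refine ⟨C + ∑ j, D j, fun k => ?_⟩
    have h1 : 1 + ‖k‖ ≤ 1 + ∑ j, ‖symb j k‖ := by
      gcongr
      refine (pi_norm_le_iff_of_nonneg (by positivity)).2 fun j => ?_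
      refine le_trans ?_ (Finset.single_le_sum (fun j _ => norm_nonneg (symb j k))
        (Finset.mem_univ j))
      simp only [symb, norm_mul, Complex.norm_intCast, Complex.norm_I, Complex.norm_real,
        Int.norm_eq_abs, Complex.norm_ofNat, mul_one, Real.norm_eq_abs, abs_of_pos Real.pi_pos]
      nlinarith [abs_nonneg (k j : ℝ), Real.pi_gt_three]
    calc (1 + ‖k‖) ^ (n + 1) * ‖fcoeff g k‖
        = (1 + ‖k‖) ^ n * ((1 + ‖k‖) * ‖fcoeff g k‖) := by ring
      _ ≤ (1 + ‖k‖) ^ n * ((1 + ∑ j, ‖symb j k‖) * ‖fcoeff g k‖) := by gcongr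
      _ = (1 + ‖k‖) ^ n * ‖fcoeff g k‖ + ∑ j, (1 + ‖k‖) ^ n * ‖fcoeff (pd j g) k‖ := by
        simp only [fcoeff_pd hg h, norm_mul, ← Finset.mul_sum, ← Finset.sum_mul]
        ring
      _ ≤ C + ∑ j, D j := add_le_add (hC k) (Finset.sum_le_sum fun j _ => hD j k)

theorem synth_fcoeff {g : (Fin d → ℝ) → ℝ} (hg : Prdc 1 g) (h : ContDiff ℝ (⊤ : ℕ∞) g)
    (x : Fin d → ℝ) : synth (fcoeff g) x = g x := by
  have hs : Summable (UnitAddTorus.mFourierCoeff fun t => (g (torusLift t) : ℂ)) :=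
    Summable.of_norm (rapidDecay_fcoeff hg h).summable
  have := UnitAddTorus.hasSum_mFourier_series_apply_of_summable
    (f := ⟨_, Complex.continuous_ofReal.comp (hg.continuous_torusLift h.continuous)⟩) hs
    (torusProj d 1 x)
  simp only [mFourier_torusProj, ContinuousMap.coe_mk, Function.comp_apply,
    hg.torusLift_torusProj] at this
  exact this.tsum_eq

end FourierCoefficients

section Coefficients

variable {d : ℕ}

/-- The squared Euclidean length of a frequency. -/
def freqSq (k : Fin d → ℤ) : ℝ := ∑ j, (k j : ℝ) ^ 2

/-- The symbol of `-Δ`. -/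
def lapSymb (k : Fin d → ℤ) : ℝ := 4 * π ^ 2 * freqSq k

/-- The symbol of the Riesz transforms `∂_i ∂_l Δ⁻¹`. -/
def riesz (i l : Fin d) (k : Fin d → ℤ) : ℝ := k i * k l / freqSq k

/-- The symbol of the Leray projection. -/
def leray (i l : Fin d) (k : Fin d → ℤ) : ℝ := (if i = l then 1 else 0) - riesz i l k

theorem freqSq_nonneg (k : Fin d → ℤ) : 0 ≤ freqSq k := Finset.sum_nonneg fun _ _ => sq_nonneg _

theorem lapSymb_nonneg (k : Fin d → ℤ) : 0 ≤ lapSymb k :=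
  mul_nonneg (by positivity) (freqSq_nonneg k)

theorem sq_le_freqSq (k : Fin d → ℤ) (j : Fin d) : (k j : ℝ) ^ 2 ≤ freqSq k :=
  Finset.single_le_sum (f := fun j => (k j : ℝ) ^ 2) (fun _ _ => sq_nonneg _) (Finset.mem_univ j)

theorem abs_riesz_le (i l : Fin d) (k : Fin d → ℤ) : |riesz i l k| ≤ 1 := by
  rw [riesz, abs_div, abs_of_nonneg (freqSq_nonneg k)]
  refine div_le_one_of_le₀ ?_ (freqSq_nonneg k)
  rw [abs_le]
  constructor <;> nlinarith [sq_le_freqSq k i, sq_le_freqSq k l, sq_nonneg ((k i : ℝ) - k l),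
    sq_nonneg ((k i : ℝ) + k l)]

theorem abs_leray_le (i l : Fin d) (k : Fin d → ℤ) : |leray i l k| ≤ 2 := by
  have h := abs_le.1 (abs_riesz_le i l k)
  rw [leray, abs_le]
  split_ifs <;> constructor <;> linarith

theorem norm_symb_le (j : Fin d) (k : Fin d → ℤ) : ‖symb j k‖ ≤ √(lapSymb k) := by
  refine Real.le_sqrt_of_sq_le ?_
  have : ‖symb j k‖ = 2 * π * |(k j : ℝ)| := by
    simp only [symb, norm_mul, Complex.norm_intCast, Complex.norm_I, Complex.norm_real,
      Complex.norm_ofNat, mul_one, Real.norm_eq_abs, abs_of_pos Real.pi_pos]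
  rw [this, mul_pow, sq_abs, lapSymb]
  nlinarith [sq_le_freqSq k j, sq_nonneg π]

theorem symb_neg (j : Fin d) (k : Fin d → ℤ) : symb j (-k) = star (symb j k) := by
  simp [symb]

theorem freqSq_neg (k : Fin d → ℤ) : freqSq (-k) = freqSq k := by simp [freqSq]

theorem lapSymb_neg (k : Fin d → ℤ) : lapSymb (-k) = lapSymb k := by rw [lapSymb, freqSq_neg, lapSymb]

theorem leray_neg (i l : Fin d) (k : Fin d → ℤ) : leray i l (-k) = leray i l k := by
  simp [leray, riesz, freqSq_neg]

theorem sum_symb_mul_leray (l : Fin d) (k : Fin d → ℤ) : ∑ i, symb i k * leray i l k = 0 := by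
  have h : ∑ i, (k i : ℝ) * leray i l k = 0 := by
    simp only [leray, riesz, mul_sub, Finset.sum_sub_distrib]
    have h1 : ∑ i, (k i : ℝ) * (k i * k l / freqSq k) = freqSq k * (k l / freqSq k) := by
      rw [freqSq, Finset.sum_mul]
      exact Finset.sum_congr rfl fun i _ => by ring
    rw [h1]
    by_cases h0 : freqSq k = 0
    · have h2 := sq_le_freqSq k l
      have h3 : (k l : ℝ) = 0 := by rw [h0] at h2; nlinarith
      simp [h0, h3]
    · rw [mul_div_cancel₀ _ h0]
      simp
  have h2 : ∑ i, symb i k * leray i l k = 2 * π * Complex.I * ((∑ i, (k i : ℝ) * leray i l k : ℝ) : ℂ) := by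
    push_cast
    rw [Finset.mul_sum]
    exact Finset.sum_congr rfl fun i _ => by rw [symb]; ring
  rw [h2, h]
  simp

theorem sum_symb_sq (k : Fin d → ℤ) : ∑ j, symb j k * symb j k = -lapSymb k := by
  simp only [lapSymb, freqSq]
  push_cast
  rw [Finset.mul_sum, ← Finset.sum_neg_distrib]
  refine Finset.sum_congr rfl fun j _ => ?_
  rw [symb]
  linear_combination (4 * (π : ℂ) ^ 2 * (k j : ℂ) ^ 2) * Complex.I_sq

/-- The coefficients of the quadratic part of the MHD system in Fourier variables; the left and
right components of the index are those of the velocity and of the magnetic field. -/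
def mhdSymb : Fin d ⊕ Fin d → Fin d ⊕ Fin d → Fin d ⊕ Fin d → (Fin d → ℤ) → ℂ
  | .inl i, .inl j, .inl l => fun k => -(leray i l k * symb j k)
  | .inl i, .inr j, .inr l => fun k => leray i l k * symb j k
  | .inr i, .inr j, .inl l => fun k => (if i = l then 1 else 0) * symb j k
  | .inr i, .inl j, .inr l => fun k => -((if i = l then 1 else 0) * symb j k)
  | _, _, _ => fun _ => 0

theorem norm_mhdSymb_le (α β γ : Fin d ⊕ Fin d) (k : Fin d → ℤ) :
    ‖mhdSymb α β γ k‖ ≤ 2 * √(lapSymb k) := by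
  have h1 : ∀ i j l : Fin d, ‖(leray i l k : ℂ) * symb j k‖ ≤ 2 * √(lapSymb k) := fun i j l => by
    rw [norm_mul, Complex.norm_real]
    exact mul_le_mul (abs_leray_le i l k) (norm_symb_le j k) (norm_nonneg _) (by norm_num)
  have h2 : ∀ i j l : Fin d, ‖(if i = l then 1 else 0 : ℂ) * symb j k‖ ≤ 2 * √(lapSymb k) :=
    fun i j l => by
      rw [norm_mul]
      refine mul_le_mul ?_ (norm_symb_le j k) (norm_nonneg _) (by norm_num)
      split_ifs <;> simp
  have h3 : ‖(0 : ℂ)‖ ≤ 2 * √(lapSymb k) := by rw [norm_zero]; positivity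
  rcases α with i | i <;> rcases β with j | j <;> rcases γ with l | l <;>
    simp only [mhdSymb, norm_neg] <;> first | exact h1 _ _ _ | exact h2 _ _ _ | exact h3

theorem mhdSymb_neg (α β γ : Fin d ⊕ Fin d) (k : Fin d → ℤ) :
    mhdSymb α β γ (-k) = star (mhdSymb α β γ k) := by
  have h : ∀ x : ℝ, (starRingEnd ℂ) (x : ℂ) = x := Complex.conj_ofReal
  rcases α with i | i <;> rcases β with j | j <;> rcases γ with l | l <;>
    simp only [mhdSymb, symb_neg, leray_neg, star_neg, star_mul', star_zero, RCLike.star_def, h,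
      apply_ite (starRingEnd ℂ), map_one, map_zero]

theorem lapSymb_le (k : Fin d → ℤ) : lapSymb k ≤ (2 * π * (d + 1) * (1 + ‖k‖)) ^ 2 := by
  have h : freqSq k ≤ d * (1 + ‖k‖) ^ 2 := by
    have := Finset.sum_le_sum fun j (_ : j ∈ Finset.univ) =>
      show (k j : ℝ) ^ 2 ≤ (1 + ‖k‖) ^ 2 by
        have h1 := norm_le_pi_norm k j
        rw [Int.norm_eq_abs] at h1
        rw [← sq_abs]
        exact pow_le_pow_left₀ (abs_nonneg _) (by linarith) 2
    simpa [freqSq] using this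
  have hd : (d : ℝ) ≤ (d + 1) ^ 2 := by nlinarith [(Nat.cast_nonneg d : (0 : ℝ) ≤ d)]
  calc lapSymb k ≤ 4 * π ^ 2 * ((d + 1) ^ 2 * (1 + ‖k‖) ^ 2) := by
        rw [lapSymb]
        gcongr
        exact h.trans (by gcongr)
    _ = _ := by ring

theorem polyBdd_mhdSymb (α β γ : Fin d ⊕ Fin d) : PolyBdd (mhdSymb α β γ) := by
  refine ⟨2 * (2 * π * (d + 1)), 1, by positivity, fun k => (norm_mhdSymb_le α β γ k).trans ?_⟩
  have := Real.sqrt_le_iff.2 ⟨by positivity, lapSymb_le k⟩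
  rw [pow_one]
  linarith

theorem polyBdd_lapSymb : PolyBdd fun k : Fin d → ℤ => (lapSymb k : ℂ) := by
  refine ⟨(2 * π * (d + 1)) ^ 2, 2, by positivity, fun k => ?_⟩
  rw [Complex.norm_real, Real.norm_of_nonneg (lapSymb_nonneg k), ← mul_pow]
  exact lapSymb_le k

theorem PolyBdd.const_mul (z : ℂ) {m : (Fin d → ℤ) → ℂ} (hm : PolyBdd m) :
    PolyBdd fun k => z * m k := by
  obtain ⟨C, n, hC, h⟩ := hm
  refine ⟨‖z‖ * C, n, by positivity, fun k => ?_⟩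
  rw [norm_mul, mul_assoc]
  exact mul_le_mul_of_nonneg_left (h k) (norm_nonneg z)

theorem polyBdd_riesz (i l : Fin d) : PolyBdd fun k => (riesz i l k : ℂ) :=
  ⟨1, 0, zero_le_one, fun k => by simpa using abs_riesz_le i l k⟩

theorem quadTerm_mhdSymb_inl (f : Fin d ⊕ Fin d → (Fin d → ℤ) → ℂ) (i : Fin d) (k : Fin d → ℤ) :
    quadTerm mhdSymb f f (.inl i) k = -∑ j, ∑ l, leray i l k * (symb j k *
      (conv (f (.inl j)) (f (.inl l)) k - conv (f (.inr j)) (f (.inr l)) k)) := by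
  rw [quadTerm]
  simp only [Fintype.sum_sum_type]
  simp only [mhdSymb, smul_eq_mul, zero_mul, Finset.sum_const_zero, add_zero, zero_add]
  rw [← Finset.sum_add_distrib, ← Finset.sum_neg_distrib]
  refine Finset.sum_congr rfl fun j _ => ?_
  rw [← Finset.sum_add_distrib, ← Finset.sum_neg_distrib]
  refine Finset.sum_congr rfl fun l _ => ?_
  ring

theorem quadTerm_mhdSymb_inr (f : Fin d ⊕ Fin d → (Fin d → ℤ) → ℂ) (i : Fin d) (k : Fin d → ℤ) :
    quadTerm mhdSymb f f (.inr i) k = ∑ j, symb j k *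
      (conv (f (.inr j)) (f (.inl i)) k - conv (f (.inl j)) (f (.inr i)) k) := by
  rw [quadTerm]
  simp only [Fintype.sum_sum_type]
  simp only [mhdSymb, smul_eq_mul, zero_mul, Finset.sum_const_zero, add_zero, zero_add]
  rw [← Finset.sum_add_distrib]
  refine Finset.sum_congr rfl fun j _ => ?_
  simp
  ring

theorem eq_zero_of_hasDerivWithinAt_eq_mul {T : ℝ} {z : ℂ} {y : ℝ → ℂ} (h0 : y 0 = 0)
    (hy : ∀ t ∈ Icc 0 T, HasDerivWithinAt y (z * y t) (Icc 0 T) t) : ∀ t ∈ Icc 0 T, y t = 0 := by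
  have hd : ∀ t ∈ Icc 0 T,
      HasDerivWithinAt (fun t : ℝ => Complex.exp (-z * t) * y t) 0 (Icc 0 T) t := by
    intro t ht
    have h1 : HasDerivAt (fun t : ℝ => Complex.exp (-z * t)) (Complex.exp (-z * t) * -z) t := by
      simpa using ((Complex.ofRealCLM.hasDerivAt (x := t)).const_mul (-z)).cexp
    refine (h1.hasDerivWithinAt.mul (hy t ht)).congr_deriv ?_
    ring
  intro t ht
  have h := constant_of_has_deriv_right_zero (fun t ht => (hd t ht).continuousWithinAt)
    (fun t ht => (hd t ⟨ht.1, ht.2.le⟩).mono_of_mem_nhdsWithin (Icc_mem_nhdsGE_of_mem ht)) t ht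
  simpa [h0] using h

end Coefficients

section Evolution

variable {d : ℕ}

/-- The right-hand side, in Fourier variables, of `∂_t a + (u·∇)a + q = κΔa + (b·∇)c` with the
transport terms in divergence form. -/
def mhdRhs (κ : ℝ) (u b : Fin d → (Fin d → ℤ) → ℂ) (a c q : (Fin d → ℤ) → ℂ) (k : Fin d → ℤ) : ℂ :=
  -((κ * lapSymb k : ℝ) : ℂ) * a k - ∑ j, symb j k * conv (u j) a k +
    ∑ j, symb j k * conv (b j) c k - q k

/-- The Fourier coefficients of the pressure. -/
def pressureCoeff (u b : Fin d → (Fin d → ℤ) → ℂ) (k : Fin d → ℤ) : ℂ :=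
  ∑ j, ∑ l, -(riesz j l k : ℂ) * (conv (u j) (u l) k + -1 * conv (b j) (b l) k)

theorem quadTerm_inl_eq_mhdRhs (κ : ℝ) (f : Fin d ⊕ Fin d → (Fin d → ℤ) → ℂ) (i : Fin d)
    (k : Fin d → ℤ) :
    -((κ * lapSymb k : ℝ) : ℂ) * f (.inl i) k + quadTerm mhdSymb f f (.inl i) k =
      mhdRhs κ (fun j => f (.inl j)) (fun j => f (.inr j)) (f (.inl i)) (f (.inr i))
        (fun k => symb i k * pressureCoeff (fun j => f (.inl j)) (fun j => f (.inr j)) k) k := by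
  have h : ∀ j l : Fin d, (leray i l k : ℂ) * symb j k =
      (if i = l then symb j k else 0) - symb i k * riesz j l k := fun j l => by
    simp only [leray, riesz, symb]
    split_ifs <;> push_cast <;> ring
  simp only [quadTerm_mhdSymb_inl, mhdRhs, pressureCoeff, ← mul_assoc, h, sub_mul,
    Finset.sum_sub_distrib, Finset.mul_sum, ite_mul, zero_mul, Finset.sum_ite_eq, Finset.mem_univ,
    if_true]
  simp only [mul_sub, mul_add, Finset.sum_sub_distrib, Finset.sum_add_distrib, mul_neg, neg_mul,
    Finset.sum_neg_distrib, one_mul]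
  ring

theorem quadTerm_inr_eq_mhdRhs (κ : ℝ) (f : Fin d ⊕ Fin d → (Fin d → ℤ) → ℂ) (i : Fin d)
    (k : Fin d → ℤ) :
    -((κ * lapSymb k : ℝ) : ℂ) * f (.inr i) k + quadTerm mhdSymb f f (.inr i) k =
      mhdRhs κ (fun j => f (.inl j)) (fun j => f (.inr j)) (f (.inr i)) (f (.inl i)) 0 k := by
  simp only [quadTerm_mhdSymb_inr, mhdRhs, mul_sub, Finset.sum_sub_distrib, Pi.zero_apply]
  ring

theorem sum_symb_mul_mhdRhs_momentum (κ : ℝ) (f : Fin d ⊕ Fin d → (Fin d → ℤ) → ℂ)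
    (k : Fin d → ℤ) :
    ∑ i, symb i k * (-((κ * lapSymb k : ℝ) : ℂ) * f (.inl i) k + quadTerm mhdSymb f f (.inl i) k) =
      -((κ * lapSymb k : ℝ) : ℂ) * ∑ i, symb i k * f (.inl i) k := by
  have h : ∑ i, symb i k * quadTerm mhdSymb f f (.inl i) k = 0 := by
    simp only [quadTerm_mhdSymb_inl, mul_neg, Finset.mul_sum, Finset.sum_neg_distrib]
    rw [Finset.sum_comm, neg_eq_zero]
    refine Finset.sum_eq_zero fun j _ => ?_
    rw [Finset.sum_comm]
    refine Finset.sum_eq_zero fun l _ => ?_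
    simp only [← mul_assoc]
    rw [← Finset.sum_mul, ← Finset.sum_mul, sum_symb_mul_leray, zero_mul, zero_mul]
  simp only [mul_add, Finset.sum_add_distrib, h, add_zero, Finset.mul_sum]
  exact Finset.sum_congr rfl fun i _ => by ring

theorem sum_symb_mul_mhdRhs_induction (κ : ℝ) (f : Fin d ⊕ Fin d → (Fin d → ℤ) → ℂ)
    (k : Fin d → ℤ) :
    ∑ i, symb i k * (-((κ * lapSymb k : ℝ) : ℂ) * f (.inr i) k + quadTerm mhdSymb f f (.inr i) k) =
      -((κ * lapSymb k : ℝ) : ℂ) * ∑ i, symb i k * f (.inr i) k := by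
  have h : ∑ i, symb i k * quadTerm mhdSymb f f (.inr i) k = 0 := by
    simp only [quadTerm_mhdSymb_inr, Finset.mul_sum, mul_sub, Finset.sum_sub_distrib]
    rw [sub_eq_zero, Finset.sum_comm]
    refine Finset.sum_congr rfl fun i _ => Finset.sum_congr rfl fun j _ => ?_
    rw [conv_comm]
    ring
  simp only [mul_add, Finset.sum_add_distrib, h, add_zero, Finset.mul_sum]
  exact Finset.sum_congr rfl fun i _ => by ring

theorem exists_mhd_coefficients {ν η : ℝ} (hν : 0 < ν) (hη : 0 < η)
    {u₀ b₀ : Fin d → (Fin d → ℤ) → ℂ} (hu : ∀ i, RapidDecay fun k => ‖u₀ i k‖)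
    (hb : ∀ i, RapidDecay fun k => ‖b₀ i k‖) (hun : ∀ i k, u₀ i (-k) = star (u₀ i k))
    (hbn : ∀ i k, b₀ i (-k) = star (b₀ i k)) (hud : ∀ k, ∑ i, symb i k * u₀ i k = 0)
    (hbd : ∀ k, ∑ i, symb i k * b₀ i k = 0) :
    ∃ T : ℝ, 0 < T ∧ ∃ u b : Fin d → (Fin d → ℤ) → ℝ → ℂ,
      ((∀ n i, SmoothCoeff T n (u i)) ∧ ∀ n i, SmoothCoeff T n (b i)) ∧
      ((∀ i k t, u i (-k) t = star (u i k t)) ∧ ∀ i k t, b i (-k) t = star (b i k t)) ∧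
      ((∀ i k, u i k 0 = u₀ i k) ∧ ∀ i k, b i k 0 = b₀ i k) ∧
      ((∀ t ∈ Icc 0 T, ∀ k, ∑ i, symb i k * u i k t = 0) ∧
        ∀ t ∈ Icc 0 T, ∀ k, ∑ i, symb i k * b i k t = 0) ∧
      (∀ i k, ∀ t ∈ Icc 0 T, HasDerivWithinAt (u i k)
        (mhdRhs ν (fun j k => u j k t) (fun j k => b j k t) (fun k => u i k t) (fun k => b i k t)
          (fun k => symb i k * pressureCoeff (fun j k => u j k t) (fun j k => b j k t) k) k)
        (Icc 0 T) t) ∧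
      ∀ i k, ∀ t ∈ Icc 0 T, HasDerivWithinAt (b i k)
        (mhdRhs η (fun j k => u j k t) (fun j k => b j k t) (fun k => b i k t) (fun k => u i k t)
          0 k) (Icc 0 T) t := by
  have hr : ∀ {κ : ℝ}, 0 < κ → ∀ k : Fin d → ℤ, 2 * √(lapSymb k) = 2 / √κ * √(κ * lapSymb k) := by
    intro κ hκ k
    have : √κ ≠ 0 := (Real.sqrt_pos.2 hκ).ne'
    rw [Real.sqrt_mul hκ.le]
    field_simp
  set κ : Fin d ⊕ Fin d → ℝ := Sum.elim (fun _ => ν) fun _ => η with hκ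
  obtain ⟨T, hT, c, hc, hcn, hc0, hcd⟩ := exists_fourier_solution (C := 2 / √ν + 2 / √η)
    (r := fun α (k : Fin d → ℤ) => κ α * lapSymb k) (m := mhdSymb)
    (by
      rintro (i | i) k
      · exact mul_nonneg hν.le (lapSymb_nonneg k)
      · exact mul_nonneg hη.le (lapSymb_nonneg k))
    (by positivity)
    (by
      intro α β γ k
      refine (norm_mhdSymb_le α β γ k).trans ?_
      rcases α with i | i
      · rw [hr hν, hκ, Sum.elim_inl]
        gcongr
        exact le_add_of_nonneg_right (by positivity)
      · rw [hr hη, hκ, Sum.elim_inr]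
        gcongr
        exact le_add_of_nonneg_left (by positivity))
    (fun α k => by rw [lapSymb_neg]) mhdSymb_neg (Sum.elim u₀ b₀)
    (by rintro (i | i); exacts [hu i, hb i]) (by rintro (i | i) k; exacts [hun i k, hbn i k])
  have hC : ∀ α, IsCoeff T (c α) := fun α => by
    obtain ⟨h1, M, hM, h2⟩ := hc α
    exact ⟨fun k => (h1 k).continuousOn, M, hM, fun k t _ => h2 k t⟩
  have hS := smoothCoeff_of_hasDerivWithinAt (fun α => by
    simpa using PolyBdd.const_mul (κ α : ℂ) polyBdd_lapSymb) polyBdd_mhdSymb hC hcd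
  have hdiv : ∀ (g : Fin d → Fin d ⊕ Fin d) (κ' : ℝ) (_ : ∀ k, ∑ i, symb i k * c (g i) k 0 = 0)
      (_ : ∀ k, ∀ t ∈ Icc 0 T, ∑ i, symb i k * (-((κ (g i) * lapSymb k : ℝ) : ℂ) * c (g i) k t +
        quadTerm mhdSymb (fun β k => c β k t) (fun β k => c β k t) (g i) k) =
        -((κ' * lapSymb k : ℝ) : ℂ) * ∑ i, symb i k * c (g i) k t),
      ∀ t ∈ Icc 0 T, ∀ k, ∑ i, symb i k * c (g i) k t = 0 := by
    intro g κ' h0 h t ht k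
    refine eq_zero_of_hasDerivWithinAt_eq_mul (T := T) (z := -((κ' * lapSymb k : ℝ) : ℂ))
      (y := fun t => ∑ i, symb i k * c (g i) k t) (h0 k) (fun t ht => ?_) t ht
    rw [← h k t ht]
    exact HasDerivWithinAt.fun_sum fun i _ => (hcd (g i) k t ht).const_mul _
  refine ⟨T, hT, fun i => c (.inl i), fun i => c (.inr i), ⟨fun n i => hS n _, fun n i => hS n _⟩,
    ⟨fun i => hcn _, fun i => hcn _⟩, ⟨fun i => hc0 _, fun i => hc0 _⟩,
    ⟨hdiv .inl ν (fun k => ?_) fun k t _ => ?_, hdiv .inr η (fun k => ?_) fun k t _ => ?_⟩,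
    fun i k t ht => ?_, fun i k t ht => ?_⟩
  · simpa [hc0] using hud k
  · exact sum_symb_mul_mhdRhs_momentum ν (fun β k => c β k t) k
  · simpa [hc0] using hbd k
  · exact sum_symb_mul_mhdRhs_induction η (fun β k => c β k t) k
  · rw [← quadTerm_inl_eq_mhdRhs ν (fun β k => c β k t)]
    exact hcd (.inl i) k t ht
  · rw [← quadTerm_inr_eq_mhdRhs η (fun β k => c β k t)]
    exact hcd (.inr i) k t ht

end Evolution

section Fields

variable {d : ℕ}

theorem RapidDecay.norm_sum {ι : Type*} (s : Finset ι) {a : ι → (Fin d → ℤ) → ℂ}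
    (ha : ∀ i, RapidDecay fun k => ‖a i k‖) : RapidDecay fun k => ‖∑ i ∈ s, a i k‖ :=
  (RapidDecay.sum s fun i _ => ha i).mono (fun _ => norm_nonneg _) fun _ => norm_sum_le _ _

theorem im_synth {a : (Fin d → ℤ) → ℂ} (ha : ∀ k, a (-k) = star (a k)) (x : Fin d → ℝ) :
    (synth a x).im = 0 :=
  Complex.conj_eq_iff_im.1 (star_synth ha x)

theorem sum_synth_symb_mul_conv {w : Fin d → (Fin d → ℤ) → ℂ} {a : (Fin d → ℤ) → ℂ}
    (hw : ∀ j, RapidDecay fun k => ‖w j k‖) (ha : RapidDecay fun k => ‖a k‖)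
    (hdiv : ∀ k, ∑ j, symb j k * w j k = 0) (x : Fin d → ℝ) :
    synth (fun k => ∑ j, symb j k * conv (w j) a k) x =
      ∑ j, synth (w j) x * synth (fun k => symb j k * a k) x := by
  have hja := fun j => ha.multiplier (polyBdd_symb j)
  have hjw := fun j => (hw j).multiplier (polyBdd_symb j)
  have hzero : ∑ j, synth (fun k => symb j k * w j k) x = 0 := by
    rw [← synth_sum _ hjw]
    simp [hdiv, synth]
  rw [synth_sum _ fun j => ((hw j).norm_conv ha).multiplier (polyBdd_symb j)]
  simp only [symb_mul_conv (hw _) ha]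
  have h : ∀ j, synth (fun k => conv (fun k => symb j k * w j k) a k +
      conv (w j) (fun k => symb j k * a k) k) x =
      synth (fun k => symb j k * w j k) x * synth a x +
        synth (w j) x * synth (fun k => symb j k * a k) x := fun j => by
    rw [synth_add ((hjw j).norm_conv ha) ((hw j).norm_conv (hja j)), synth_conv (hjw j) ha,
      synth_conv (hw j) (hja j)]
  simp only [h, Finset.sum_add_distrib, ← Finset.sum_mul, hzero, zero_mul, zero_add]

theorem synth_neg_lapSymb_mul {a : (Fin d → ℤ) → ℂ} (ha : RapidDecay fun k => ‖a k‖) (κ : ℝ)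
    (x : Fin d → ℝ) : synth (fun k => -((κ * lapSymb k : ℝ) : ℂ) * a k) x =
      κ * ∑ j, synth (fun k => symb j k * (symb j k * a k)) x := by
  rw [← synth_sum _ fun j => (ha.multiplier (polyBdd_symb j)).multiplier (polyBdd_symb j),
    ← synth_const_mul]
  congr 1
  funext k
  simp only [← mul_assoc, ← Finset.sum_mul]
  rw [mul_assoc _ (∑ j, _), mul_comm (∑ j, _), sum_symb_sq]
  push_cast
  ring

theorem re_synth_mhdRhs {u b : Fin d → (Fin d → ℤ) → ℂ} {a c q : (Fin d → ℤ) → ℂ}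
    (hu : ∀ j, RapidDecay fun k => ‖u j k‖) (hb : ∀ j, RapidDecay fun k => ‖b j k‖)
    (ha : RapidDecay fun k => ‖a k‖) (hc : RapidDecay fun k => ‖c k‖)
    (hq : RapidDecay fun k => ‖q k‖)
    (hun : ∀ j k, u j (-k) = star (u j k)) (hbn : ∀ j k, b j (-k) = star (b j k))
    (hud : ∀ k, ∑ j, symb j k * u j k = 0) (hbd : ∀ k, ∑ j, symb j k * b j k = 0) (κ : ℝ)
    (x : Fin d → ℝ) : (synth (mhdRhs κ u b a c q) x).re =
      κ * (∑ j, pd j (pd j fun x => (synth a x).re) x) -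
      (∑ j, (synth (u j) x).re * pd j (fun x => (synth a x).re) x) +
      (∑ j, (synth (b j) x).re * pd j (fun x => (synth c x).re) x) - (synth q x).re := by
  have h1 : RapidDecay fun k => ‖-((κ * lapSymb k : ℝ) : ℂ) * a k‖ := by
    simpa [mul_assoc] using ha.multiplier (PolyBdd.const_mul (κ : ℂ) polyBdd_lapSymb)
  have h2 : RapidDecay fun k => ‖∑ j, symb j k * conv (u j) a k‖ :=
    RapidDecay.norm_sum _ fun j => ((hu j).norm_conv ha).multiplier (polyBdd_symb j)
  have h3 : RapidDecay fun k => ‖∑ j, symb j k * conv (b j) c k‖ :=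
    RapidDecay.norm_sum _ fun j => ((hb j).norm_conv hc).multiplier (polyBdd_symb j)
  have h4 : synth (mhdRhs κ u b a c q) x = κ * ∑ j, synth (fun k => symb j k * (symb j k * a k)) x -
      ∑ j, synth (u j) x * synth (fun k => symb j k * a k) x +
      ∑ j, synth (b j) x * synth (fun k => symb j k * c k) x - synth q x := by
    rw [← sum_synth_symb_mul_conv hu ha hud, ← sum_synth_symb_mul_conv hb hc hbd,
      ← synth_neg_lapSymb_mul ha, ← synth_sub h1 h2, ← synth_add (h1.norm_sub h2) h3,
      ← synth_sub ((h1.norm_sub h2).norm_add h3) hq]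
    rfl
  simp only [h4, Complex.add_re, Complex.sub_re, Complex.re_sum, Complex.mul_re, Complex.ofReal_re,
    Complex.ofReal_im, zero_mul, sub_zero, im_synth (hun _), im_synth (hbn _), pd_re_synth ha,
    pd_re_synth hc, pd_re_synth (ha.multiplier (polyBdd_symb _))]

/-- The real field with time-dependent Fourier coefficients `c`. -/
def realField (c : (Fin d → ℤ) → ℝ → ℂ) (t : ℝ) (x : Fin d → ℝ) : ℝ :=
  (synth (fun k => c k t) x).re

theorem contDiffOn_realField {T : ℝ} (hT : 0 < T) {c : (Fin d → ℤ) → ℝ → ℂ}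
    (hc : ∀ n, SmoothCoeff T n c) : ContDiffOn ℝ (⊤ : ℕ∞)
      (fun p : ℝ × (Fin d → ℝ) => realField c p.1 p.2) (Icc 0 T ×ˢ univ) :=
  contDiffOn_infty.2 fun n => Complex.reCLM.contDiff.comp_contDiffOn (contDiffOn_synth hT (hc n))

theorem prdc_realField (c : (Fin d → ℤ) → ℝ → ℂ) (t : ℝ) : Prdc 1 (realField c t) := fun x i => by
  rw [realField, synth_add_single, realField]

theorem divg_realField {T : ℝ} {c : Fin d → (Fin d → ℤ) → ℝ → ℂ} (hc : ∀ i, IsCoeff T (c i))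
    {t : ℝ} (ht : t ∈ Icc 0 T) (hdiv : ∀ k, ∑ i, symb i k * c i k t = 0) (x : Fin d → ℝ) :
    divg (fun x i => realField (c i) t x) x = 0 := by
  have h := fun i => (hc i).rapidDecay ht
  have h2 : ∀ i, pd i (fun x => realField (c i) t x) x =
      (synth (fun k => symb i k * c i k t) x).re := fun i => congrFun (pd_re_synth (h i) i) x
  simp only [divg, h2, ← Complex.re_sum]
  rw [← synth_sum _ fun i => (h i).multiplier (polyBdd_symb i)]
  simp [hdiv, synth]

theorem smoothCoeff_pressureCoeff {T : ℝ} {n : ℕ} {u b : Fin d → (Fin d → ℤ) → ℝ → ℂ}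
    (hu : ∀ i, SmoothCoeff T n (u i)) (hb : ∀ i, SmoothCoeff T n (b i)) :
    SmoothCoeff T n fun k t => pressureCoeff (fun j k => u j k t) (fun j k => b j k t) k := by
  refine SmoothCoeff.sum _ fun j => SmoothCoeff.sum _ fun l => ?_
  refine SmoothCoeff.mul (m := fun k => -(riesz j l k : ℂ)) ?_ (((hu j).conv (hu l)).add
    (((hb j).conv (hb l)).mul (m := fun _ => -1) ⟨1, 0, by simp⟩))
  obtain ⟨C, m, hC, h⟩ := polyBdd_riesz j l
  exact ⟨C, m, hC, fun k => by simpa using h k⟩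

theorem exists_mhd_solution {ν η : ℝ} (hν : 0 < ν) (hη : 0 < η)
    {u₀ b₀ : (Fin d → ℝ) → Fin d → ℝ} (hu : ContDiff ℝ (⊤ : ℕ∞) u₀) (hup : Prdc 1 u₀)
    (hud : ∀ x, divg u₀ x = 0) (hb : ContDiff ℝ (⊤ : ℕ∞) b₀) (hbp : Prdc 1 b₀)
    (hbd : ∀ x, divg b₀ x = 0) :
    ∃ T : ℝ, 0 < T ∧ ∃ (u b : ℝ → (Fin d → ℝ) → Fin d → ℝ) (P : ℝ → (Fin d → ℝ) → ℝ),
      IsMHD d 1 ν η (Ico 0 T) u b P ∧ u 0 = u₀ ∧ b 0 = b₀ ∧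
      ∃ β : ℝ → (Fin d → ℝ) → Fin d → ℝ,
        (∀ i, ContinuousOn (fun p : ℝ × (Fin d → ℝ) => β p.1 p.2 i) (Icc 0 T ×ˢ univ)) ∧
        (∀ x i, ∀ t ∈ Icc 0 T, HasDerivWithinAt (fun s => b s x i) (β t x i) (Icc 0 T) t) ∧
        ∀ x i, β 0 x i = η * (∑ j, pd j (pd j fun y => b₀ y i) x) -
          (∑ j, u₀ x j * pd j (fun y => b₀ y i) x) + ∑ j, b₀ x j * pd j (fun y => u₀ y i) x := by
  have hcomp : ∀ {w : (Fin d → ℝ) → Fin d → ℝ} (_ : ContDiff ℝ (⊤ : ℕ∞) w) (_ : Prdc 1 w) i,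
      ContDiff ℝ (⊤ : ℕ∞) (fun x => w x i) ∧ Prdc 1 fun x => w x i := fun hw hwp i =>
    ⟨contDiff_pi.1 hw i, fun x j => congrFun (hwp x j) i⟩
  have hdiv : ∀ {w : (Fin d → ℝ) → Fin d → ℝ} (_ : ContDiff ℝ (⊤ : ℕ∞) w) (_ : Prdc 1 w)
      (_ : ∀ x, divg w x = 0) k, ∑ i, symb i k * fcoeff (fun x => w x i) k = 0 := by
    intro w hw hwp h k
    simp only [← fcoeff_pd (hcomp hw hwp _).2 (hcomp hw hwp _).1]
    rw [← fcoeff_sum _ (fun i => (hcomp hw hwp i).2.pd i)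
      fun i => (contDiff_pd (hcomp hw hwp i).1 i).continuous]
    have : (fun x => ∑ i, pd i (fun x => w x i) x) = fun _ => 0 := funext h
    rw [this]
    simp [fcoeff]
  obtain ⟨T, hT, u, b, ⟨hSu, hSb⟩, ⟨hun, hbn⟩, ⟨hu0, hb0⟩, ⟨hudiv, hbdiv⟩, hdu, hdb⟩ :=
    exists_mhd_coefficients hν hη
      (fun i => rapidDecay_fcoeff (hcomp hu hup i).2 (hcomp hu hup i).1)
      (fun i => rapidDecay_fcoeff (hcomp hb hbp i).2 (hcomp hb hbp i).1)
      (fun i => fcoeff_neg _) (fun i => fcoeff_neg _) (hdiv hu hup hud) (hdiv hb hbp hbd)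
  have hSp := fun n => smoothCoeff_pressureCoeff (hSu n) (hSb n)
  have hsub : Ico 0 T ×ˢ (univ : Set (Fin d → ℝ)) ⊆ Icc 0 T ×ˢ univ :=
    prod_mono_left Ico_subset_Icc_self
  have hud' := uniqueDiffOn_Icc hT
  have hderiv : ∀ {c : (Fin d → ℤ) → ℝ → ℂ} {r : (Fin d → ℤ) → ℝ → ℂ} (_ : SmoothCoeff T 1 c)
      (_ : ∀ k, ∀ t ∈ Icc 0 T, HasDerivWithinAt (c k) (r k t) (Icc 0 T) t),
      ContinuousOn (fun p : ℝ × (Fin d → ℝ) => (synth (fun k => r k p.1) p.2).re)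
        (Icc 0 T ×ˢ univ) ∧
      ∀ x, ∀ t ∈ Icc 0 T, HasDerivWithinAt (fun s => realField c s x)
        (synth (fun k => r k t) x).re (Icc 0 T) t := by
    intro c r hc hr
    obtain ⟨hc0, c', hc', hd⟩ := hc
    have heq : ∀ t ∈ Icc 0 T, (fun k => r k t) = fun k => c' k t := fun t ht => funext fun k =>
      (hud' t ht).eq_deriv _ (hr k t ht) (hd k t ht)
    refine ⟨?_, fun x t ht => ?_⟩
    · have h := Complex.continuous_re.comp_continuousOn
        (contDiffOn_synth hT (n := 0) hc').continuousOn
      exact h.congr fun p hp => by simp only [Function.comp_apply, heq p.1 hp.1]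
    · rw [heq t ht]
      exact hasDerivWithinAt_re_synth hc0 hc' hd ht x
  have hRu : ∀ i t, t ∈ Icc 0 T → RapidDecay fun k => ‖u i k t‖ := fun i t ht =>
    (hSu 0 i).isCoeff.rapidDecay ht
  have hRb : ∀ i t, t ∈ Icc 0 T → RapidDecay fun k => ‖b i k t‖ := fun i t ht =>
    (hSb 0 i).isCoeff.rapidDecay ht
  have hRp : ∀ t, t ∈ Icc 0 T → RapidDecay fun k => ‖pressureCoeff (fun j k => u j k t)
      (fun j k => b j k t) k‖ := fun t ht => (hSp 0).isCoeff.rapidDecay ht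
  have hR0 : RapidDecay fun k : Fin d → ℤ => ‖(0 : (Fin d → ℤ) → ℂ) k‖ :=
    ⟨fun _ => norm_nonneg _, fun n => by simp⟩
  have hu00 : (fun x i => realField (u i) 0 x) = u₀ := by
    funext x i
    simp only [realField, hu0]
    exact congrArg Complex.re (synth_fcoeff (hcomp hu hup i).2 (hcomp hu hup i).1 x)
  have hb00 : (fun x i => realField (b i) 0 x) = b₀ := by
    funext x i
    simp only [realField, hb0]
    exact congrArg Complex.re (synth_fcoeff (hcomp hb hbp i).2 (hcomp hb hbp i).1 x)
  have hU := fun i => hderiv (hSu 1 i) (hdu i)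
  have hB := fun i => hderiv (hSb 1 i) (hdb i)
  have hmom : ∀ t ∈ Icc 0 T, ∀ x i, _ := fun t ht x i => re_synth_mhdRhs (fun j => hRu j t ht)
    (fun j => hRb j t ht) (hRu i t ht) (hRb i t ht) ((hRp t ht).multiplier (polyBdd_symb i))
    (fun j k => hun j k t) (fun j k => hbn j k t) (hudiv t ht) (hbdiv t ht) ν x
  have hind : ∀ t ∈ Icc 0 T, ∀ x i, _ := fun t ht x i => re_synth_mhdRhs (fun j => hRu j t ht)
    (fun j => hRb j t ht) (hRb i t ht) (hRu i t ht) hR0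
    (fun j k => hun j k t) (fun j k => hbn j k t) (hudiv t ht) (hbdiv t ht) η x
  refine ⟨T, hT, fun t x i => realField (u i) t x, fun t x i => realField (b i) t x,
    realField fun k t => pressureCoeff (fun j k => u j k t) (fun j k => b j k t) k,
    ⟨?_, ?_, ?_, ?_, ?_, ?_, ?_, ?_, ?_, ?_⟩, hu00, hb00, fun t x i => _, fun i => (hB i).1,
    fun x i t ht => (hB i).2 x t ht, fun x i => ?_⟩
  · exact contDiffOn_pi.2 fun i => (contDiffOn_realField hT fun n => hSu n i).mono hsub
  · exact contDiffOn_pi.2 fun i => (contDiffOn_realField hT fun n => hSb n i).mono hsub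
  · exact (contDiffOn_realField hT hSp).mono hsub
  · exact fun t _ x j => funext fun i => prdc_realField (u i) t x j
  · exact fun t _ x j => funext fun i => prdc_realField (b i) t x j
  · exact fun t _ => prdc_realField _ t
  · exact fun t ht => divg_realField (fun i => (hSu 0 i).isCoeff) (Ico_subset_Icc_self ht)
      (hudiv t (Ico_subset_Icc_self ht))
  · exact fun t ht => divg_realField (fun i => (hSb 0 i).isCoeff) (Ico_subset_Icc_self ht)
      (hbdiv t (Ico_subset_Icc_self ht))
  · intro t ht h0 x i
    have htc := Ico_subset_Icc_self ht
    have h := ((hU i).2 x t htc).hasDerivAt (Icc_mem_nhds h0 ht.2)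
    rw [h.deriv, show pd i (realField (fun k t => pressureCoeff (fun j k => u j k t)
      (fun j k => b j k t) k) t) x = _ from congrFun (pd_re_synth (hRp t htc) i) x]
    have hlin : ∀ {D L S B Q : ℝ}, D = L - S + B - Q → D + S + Q = L + B := fun h => by
      rw [h]; ring
    exact hlin (hmom t htc x i)
  · intro t ht h0 x i
    have htc := Ico_subset_Icc_self ht
    have h := ((hB i).2 x t htc).hasDerivAt (Icc_mem_nhds h0 ht.2)
    rw [h.deriv]
    have hlin : ∀ {D L S B Q : ℝ}, Q = 0 → D = L - S + B - Q → D + S = B + L := fun hQ h => by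
      rw [h, hQ]; ring
    exact hlin (by simp [synth]) (hind t htc x i)
  · rw [← hu00, ← hb00]
    have hlin : ∀ {D L S B Q : ℝ}, Q = 0 → D = L - S + B - Q → D = L - S + B := fun hQ h => by
      rw [h, hQ, sub_zero]
    exact hlin (by simp [synth]) (hind 0 ⟨le_rfl, hT.le⟩ x i)

end Fields

section Lines

variable {d : ℕ}

theorem exists_isMagLine_singleton_iff {w : (Fin d → ℝ) → Fin d → ℝ} :
    (∃ p, IsMagLine d 1 w {p}) ↔ ∃ x, w x = 0 := by
  constructor
  · rintro ⟨p, γ, hγ, hp⟩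
    have hmem : ∀ τ, torusProj d 1 (γ τ) = p := fun τ => by
      have : torusProj d 1 (γ τ) ∈ ({p} : Set (Fin d → AddCircle (1 : ℝ))) :=
        hp ▸ mem_image_of_mem _ (mem_range_self τ)
      exact this
    have hInt : ∀ τ i, ∃ n : ℤ, (n : ℝ) = γ 0 i - γ τ i := fun τ i => by
      have h : ((γ τ i : ℝ) : AddCircle (1 : ℝ)) = (γ 0 i : ℝ) :=
        congrFun ((hmem τ).trans (hmem 0).symm) i
      obtain ⟨n, hn⟩ := (AddSubgroup.mem_zmultiples_iff).1 (QuotientAddGroup.eq.1 h)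
      exact ⟨n, by rw [← zsmul_one]; linarith⟩
    have hconst : γ =ᶠ[𝓝 0] fun _ => γ 0 := by
      have h := Metric.continuousAt_iff.1 (hγ 0).continuousAt 1 one_pos
      obtain ⟨δ, hδ, h⟩ := h
      filter_upwards [Metric.ball_mem_nhds 0 hδ] with τ hτ
      funext i
      obtain ⟨n, hn⟩ := hInt τ i
      have h1 : |(n : ℝ)| < 1 := by
        rw [hn, abs_sub_comm]
        exact (dist_le_pi_dist (γ τ) (γ 0) i).trans_lt (h hτ)
      have h2 : n = 0 := Int.abs_lt_one_iff.1 (by exact_mod_cast h1)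
      rw [h2] at hn
      push_cast at hn
      linarith
    exact ⟨γ 0, (hγ 0).unique ((hasDerivAt_const (0 : ℝ) (γ 0)).congr_of_eventuallyEq hconst)⟩
  · rintro ⟨x, hx⟩
    refine ⟨torusProj d 1 x, fun _ => x, fun τ => ?_, by simp⟩
    rw [hx]
    exact hasDerivAt_const τ x

theorem MagLinesEquiv.exists_eq_zero {w v : (Fin d → ℝ) → Fin d → ℝ} (h : MagLinesEquiv d 1 w v)
    (hw : ∃ x, w x = 0) : ∃ x, v x = 0 := by
  obtain ⟨φ, hφ⟩ := h
  obtain ⟨p, hp⟩ := exists_isMagLine_singleton_iff.2 hw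
  exact exists_isMagLine_singleton_iff.1 ⟨φ p, by simpa using (hφ {p}).1 hp⟩

theorem IsMHD.mono {L ν η : ℝ} {J J' : Set ℝ} {u b : ℝ → (Fin d → ℝ) → Fin d → ℝ}
    {P : ℝ → (Fin d → ℝ) → ℝ} (h : IsMHD d L ν η J u b P) (hJ : J' ⊆ J) :
    IsMHD d L ν η J' u b P where
  smooth_u := h.smooth_u.mono (prod_mono_left hJ)
  smooth_b := h.smooth_b.mono (prod_mono_left hJ)
  smooth_P := h.smooth_P.mono (prod_mono_left hJ)
  periodic_u t ht := h.periodic_u t (hJ ht)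
  periodic_b t ht := h.periodic_b t (hJ ht)
  periodic_P t ht := h.periodic_P t (hJ ht)
  div_u t ht := h.div_u t (hJ ht)
  div_b t ht := h.div_b t (hJ ht)
  momentum t ht := h.momentum t (hJ ht)
  induction_eq t ht := h.induction_eq t (hJ ht)

theorem Prdc.exists_mem_box {E : Type*} {w : (Fin d → ℝ) → E} (hw : Prdc 1 w) (x : Fin d → ℝ) :
    ∃ y ∈ box d 1, w y = w x := by
  refine ⟨fun i => Int.fract (x i), ⟨fun i => Int.fract_nonneg _, fun i => (Int.fract_lt_one _).le⟩,
    hw.eq_of_torusProj_eq (funext fun i => QuotientAddGroup.eq.2 ?_)⟩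
  exact AddSubgroup.mem_zmultiples_iff.2 ⟨⌊x i⌋, by
    rw [zsmul_one, neg_add_eq_sub]; linarith [Int.self_sub_floor (x i)]⟩

theorem eventually_forall_ne_zero {T : ℝ} (hT : 0 < T) {b β : ℝ → (Fin d → ℝ) → Fin d → ℝ}
    (hp : ∀ t ∈ Ico 0 T, Prdc 1 (b t))
    (hb : ContinuousOn (fun p : ℝ × (Fin d → ℝ) => b p.1 p.2) (Ico 0 T ×ˢ univ))
    (hβ : ∀ i, ContinuousOn (fun p : ℝ × (Fin d → ℝ) => β p.1 p.2 i) (Icc 0 T ×ˢ univ))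
    (hd : ∀ x i, ∀ t ∈ Icc 0 T, HasDerivWithinAt (fun s => b s x i) (β t x i) (Icc 0 T) t)
    (h0 : ∀ x, b 0 x = 0 → ∃ i, 0 < β 0 x i ∧ ∀ᶠ y in 𝓝 x, 0 ≤ b 0 y i) :
    ∀ᶠ t in 𝓝 (0 : ℝ), 0 < t → ∀ x, b t x ≠ 0 := by
  have hloc : ∀ x ∈ box d 1, ∀ᶠ p in 𝓝 ((0 : ℝ), x), 0 < p.1 → b p.1 p.2 ≠ 0 := by
    intro x _
    have hlt : ∀ᶠ p in 𝓝 ((0 : ℝ), x), p.1 < T :=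
      continuous_fst.continuousAt.eventually (gt_mem_nhds hT)
    by_cases hx : b 0 x = 0
    · obtain ⟨i, hi, hn⟩ := h0 x hx
      have hpos := eventually_nhdsWithin_iff.1
        (((hβ i) (0, x) ⟨⟨le_rfl, hT.le⟩, mem_univ x⟩).eventually (lt_mem_nhds hi))
      obtain ⟨ε, hε, hε'⟩ := Metric.eventually_nhds_iff.1 hpos
      obtain ⟨δ, hδ, hδ'⟩ := Metric.eventually_nhds_iff.1 hn
      filter_upwards [Metric.ball_mem_nhds _ hε, Metric.ball_mem_nhds _ hδ, hlt] with
        p hpε hpδ hpT hp0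
      obtain ⟨t, y⟩ := p
      simp only [Metric.mem_ball, Prod.dist_eq, max_lt_iff] at hpε hpδ hpT hp0
      obtain ⟨s, hs, hs'⟩ := exists_hasDerivAt_eq_slope (fun s => b s y i) (fun s => β s y i) hp0
        (fun s hs => (hd y i s ⟨hs.1, hs.2.trans hpT.le⟩).continuousWithinAt.mono
          (Icc_subset_Icc_right hpT.le))
        (fun s hs => (hd y i s ⟨hs.1.le, (hs.2.trans hpT).le⟩).hasDerivAt
          (Icc_mem_nhds hs.1 (hs.2.trans hpT)))
      have h1 : 0 < β s y i := by
        refine hε' (y := (s, y)) ?_ ⟨⟨hs.1.le, (hs.2.trans hpT).le⟩, mem_univ y⟩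
        rw [Prod.dist_eq, max_lt_iff]
        refine ⟨lt_of_le_of_lt ?_ hpε.1, hpε.2⟩
        simp only [Real.dist_eq, sub_zero, abs_of_pos hs.1, abs_of_pos hp0]
        exact hs.2.le
      have h2 := hδ' hpδ.2
      rw [hs', sub_zero] at h1
      have h3 : 0 < b t y i - b 0 y i := (div_pos_iff_of_pos_right hp0).1 h1
      intro hz
      have h4 : b t y i = 0 := congrFun hz i
      linarith
    · have h := eventually_nhdsWithin_iff.1 ((hb (0, x) ⟨⟨le_rfl, hT⟩, mem_univ x⟩).eventually
        (isOpen_ne.mem_nhds hx))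
      filter_upwards [h, hlt] with p h1 h2 h3
      exact h1 ⟨⟨h3.le, h2⟩, mem_univ _⟩
  filter_upwards [IsCompact.eventually_forall_of_forall_eventually (K := box d 1)
    (P := fun t x => 0 < t → b t x ≠ 0) isCompact_Icc hloc,
    gt_mem_nhds hT] with t ht htT ht0 x
  obtain ⟨y, hy, hyx⟩ := (hp t ⟨ht0.le, htT⟩).exists_mem_box x
  exact hyx ▸ ht y hy ht0

end Lines

section Shear

theorem setIntegral_box_comp_eval {d : ℕ} (i : Fin d) {g : ℝ → ℝ} (hg : Continuous g) :
    ∫ x in box d 1, g (x i) = ∫ s in (0 : ℝ)..1, g s := by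
  have : IsProbabilityMeasure ((volume : Measure ℝ).restrict (Icc 0 1)) := ⟨by simp⟩
  have h : (volume : Measure (Fin d → ℝ)).restrict (box d 1) =
      Measure.pi fun _ => (volume : Measure ℝ).restrict (Icc 0 1) := by
    rw [box, ← pi_univ_Icc, volume_pi, Measure.restrict_pi_pi]
    rfl
  have hm := measurePreserving_eval (fun _ : Fin d => (volume : Measure ℝ).restrict (Icc 0 1)) i
  rw [h, intervalIntegral.integral_of_le zero_le_one, ← integral_Icc_eq_integral_Ioc]
  have hmap := integral_map (μ := Measure.pi fun _ : Fin d => (volume : Measure ℝ).restrict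
    (Icc 0 1)) hm.aemeasurable (hg.aestronglyMeasurable (μ := _))
  rw [hm.map_eq] at hmap
  exact hmap.symm

theorem pd_comp_eval {d : ℕ} (i j : Fin d) {g : ℝ → ℝ} {g' : ℝ} {x : Fin d → ℝ}
    (hg : HasDerivAt g g' (x i)) : pd j (fun y => g (y i)) x = if j = i then g' else 0 := by
  have h : HasFDerivAt (fun y : Fin d → ℝ => g (y i))
      (g' • (ContinuousLinearMap.proj i : (Fin d → ℝ) →L[ℝ] ℝ)) x :=
    hg.comp_hasFDerivAt x (ContinuousLinearMap.proj i : (Fin d → ℝ) →L[ℝ] ℝ).hasFDerivAt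
  rw [pd, h.fderiv]
  simp [Pi.single_apply, eq_comm]

theorem intervalIntegral_cos_two_pi_mul {n : ℕ} (hn : n ≠ 0) :
    ∫ s in (0 : ℝ)..1, Real.cos (2 * π * n * s) = 0 := by
  have h : 2 * π * (n : ℝ) ≠ 0 := by positivity
  rw [intervalIntegral.integral_comp_mul_left (fun s => Real.cos s) h, integral_cos]
  have := Real.sin_nat_mul_pi (2 * n)
  push_cast at this
  simp [show 2 * π * (n : ℝ) = 2 * n * π by ring, this]

/-- The first profile of the initial magnetic field: it vanishes to second order at the integers,
where it is convex. -/
def shearProfile (s : ℝ) : ℝ := Real.cos (2 * π * s) - Real.cos (4 * π * s)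

/-- A planar shear field on the three-dimensional torus vanishing exactly at integer heights. -/
def shearField (c : ℝ) (x : Fin 3 → ℝ) : Fin 3 → ℝ :=
  ![c * shearProfile (x 2), c * Real.sin (2 * π * x 2), 0]

theorem hasDerivAt_shearProfile (s : ℝ) : HasDerivAt shearProfile
    (4 * π * Real.sin (4 * π * s) - 2 * π * Real.sin (2 * π * s)) s := by
  have h1 := (Real.hasDerivAt_cos (2 * π * s)).comp s ((hasDerivAt_id s).const_mul (2 * π))
  have h2 := (Real.hasDerivAt_cos (4 * π * s)).comp s ((hasDerivAt_id s).const_mul (4 * π))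
  refine (h1.sub h2).congr_deriv ?_
  ring

theorem hasDerivAt_deriv_shearProfile (s : ℝ) :
    HasDerivAt (fun s => 4 * π * Real.sin (4 * π * s) - 2 * π * Real.sin (2 * π * s))
      (16 * π ^ 2 * Real.cos (4 * π * s) - 4 * π ^ 2 * Real.cos (2 * π * s)) s := by
  have h1 := (Real.hasDerivAt_sin (4 * π * s)).comp s ((hasDerivAt_id s).const_mul (4 * π))
  have h2 := (Real.hasDerivAt_sin (2 * π * s)).comp s ((hasDerivAt_id s).const_mul (2 * π))
  refine ((h1.const_mul (4 * π)).sub (h2.const_mul (2 * π))).congr_deriv ?_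
  ring

theorem contDiff_shearField (c : ℝ) : ContDiff ℝ (⊤ : ℕ∞) (shearField c) := by
  refine contDiff_pi.2 fun i => ?_
  fin_cases i <;> simp only [shearField, shearProfile] <;> simp <;> fun_prop

theorem prdc_shearField (c : ℝ) : Prdc 1 (shearField c) := by
  intro x i
  by_cases hi : i = 2
  · subst hi
    have h1 : Real.cos (2 * π * (x 2 + 1)) = Real.cos (2 * π * x 2) := by
      rw [mul_add, mul_one, Real.cos_add_two_pi]
    have h2 : Real.sin (2 * π * (x 2 + 1)) = Real.sin (2 * π * x 2) := by
      rw [mul_add, mul_one, Real.sin_add_two_pi]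
    have h3 : Real.cos (4 * π * (x 2 + 1)) = Real.cos (4 * π * x 2) := by
      rw [show 4 * π * (x 2 + 1) = 4 * π * x 2 + 2 * π + 2 * π by ring, Real.cos_add_two_pi,
        Real.cos_add_two_pi]
    simp [shearField, shearProfile, h1, h2, h3]
  · simp [shearField, Pi.single_eq_of_ne (Ne.symm hi)]

theorem divg_shearField (c : ℝ) (x : Fin 3 → ℝ) : divg (shearField c) x = 0 := by
  have h0 : pd 0 (fun y => shearField c y 0) x = 0 :=
    (pd_comp_eval 2 0 ((hasDerivAt_shearProfile (x 2)).const_mul c)).trans (by simp)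
  have h1 : pd 1 (fun y => shearField c y 1) x = 0 := by
    have h : HasDerivAt (fun s => c * Real.sin (2 * π * s)) _ (x 2) :=
      (((Real.hasDerivAt_sin _).comp _ ((hasDerivAt_id (x 2)).const_mul (2 * π))).const_mul c)
    exact (pd_comp_eval 2 1 h).trans (by simp)
  have h2 : pd 2 (fun y => shearField c y 2) x = 0 :=
    (pd_comp_eval (g := fun _ => 0) 2 2 (hasDerivAt_const (x 2) 0)).trans (by simp)
  rw [divg, Fin.sum_univ_three, h0, h1, h2]
  simp

theorem zeroAvg_shearField (c : ℝ) : ZeroAvg 1 (shearField c) := by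
  have hcos : ∀ a : ℝ, a = 2 * π * (1 : ℕ) ∨ a = 2 * π * (2 : ℕ) →
      ∫ s in (0 : ℝ)..1, Real.cos (a * s) = 0 := by
    rintro a (rfl | rfl) <;> exact intervalIntegral_cos_two_pi_mul (by simp)
  intro i
  fin_cases i
  · refine (setIntegral_box_comp_eval (d := 3) 2 (g := fun s => c * shearProfile s)
      (by unfold shearProfile; fun_prop)).trans ?_
    rw [intervalIntegral.integral_const_mul]
    simp only [shearProfile]
    rw [intervalIntegral.integral_sub, hcos _ (Or.inl (by simp)),
      hcos _ (Or.inr (by push_cast; ring)), sub_zero, mul_zero]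
    all_goals exact Continuous.intervalIntegrable (by fun_prop) _ _
  · refine (setIntegral_box_comp_eval (d := 3) 2 (g := fun s => c * Real.sin (2 * π * s))
      (by fun_prop)).trans ?_
    rw [intervalIntegral.integral_const_mul, intervalIntegral.integral_comp_mul_left
      (fun s => Real.sin s) (by positivity)]
    simp
  · simp [shearField]

theorem l2norm_shearField {M : ℝ} (hM : 0 ≤ M) : L2norm 1 (shearField (M * √(2 / 3))) = M := by
  have hsq : ∀ x : Fin 3 → ℝ, ∑ i, shearField (M * √(2 / 3)) x i ^ 2 =
      M ^ 2 * (2 / 3) * (shearProfile (x 2) ^ 2 + Real.sin (2 * π * x 2) ^ 2) := fun x => by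
    have : √(2 / 3 : ℝ) ^ 2 = 2 / 3 := Real.sq_sqrt (by norm_num)
    simp only [Fin.sum_univ_three, shearField, Matrix.cons_val, mul_pow, this]
    ring
  have htrig : ∀ s, shearProfile s ^ 2 + Real.sin (2 * π * s) ^ 2 = 3 / 2 -
      Real.cos (2 * π * (3 : ℕ) * s) - Real.cos (2 * π * (1 : ℕ) * s) +
      1 / 2 * Real.cos (2 * π * (4 : ℕ) * s) := fun s => by
    have h3 : Real.cos (2 * π * (3 : ℕ) * s) = 4 * Real.cos (2 * π * s) ^ 3 -
        3 * Real.cos (2 * π * s) := by rw [← Real.cos_three_mul]; push_cast; ring_nf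
    have h2 : Real.cos (4 * π * s) = 2 * Real.cos (2 * π * s) ^ 2 - 1 := by
      rw [← Real.cos_two_mul]; ring_nf
    have h4 : Real.cos (2 * π * (4 : ℕ) * s) = 2 * Real.cos (4 * π * s) ^ 2 - 1 := by
      rw [← Real.cos_two_mul]; push_cast; ring_nf
    rw [shearProfile, h4, h3, h2, Real.sin_sq]
    push_cast
    ring_nf
  rw [L2norm]
  simp only [hsq]
  rw [integral_const_mul, setIntegral_box_comp_eval 2 (g := fun s => shearProfile s ^ 2 +
    Real.sin (2 * π * s) ^ 2) (by unfold shearProfile; fun_prop)]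
  simp only [htrig]
  rw [intervalIntegral.integral_add, intervalIntegral.integral_sub, intervalIntegral.integral_sub,
    intervalIntegral.integral_const_mul, intervalIntegral_cos_two_pi_mul (by simp),
    intervalIntegral_cos_two_pi_mul (by simp), intervalIntegral_cos_two_pi_mul (by simp)]
  · rw [show M ^ 2 * (2 / 3) * ((∫ _ in (0 : ℝ)..1, (3 / 2 : ℝ)) - 0 - 0 + 1 / 2 * 0) = M ^ 2 by
      rw [intervalIntegral.integral_const, smul_eq_mul]; ring]
    exact Real.sqrt_sq hM
  all_goals exact Continuous.intervalIntegrable (by fun_prop) _ _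

theorem cos_eq_one_of_shearField_eq_zero {c : ℝ} (hc : c ≠ 0) {x : Fin 3 → ℝ}
    (hx : shearField c x = 0) : Real.cos (2 * π * x 2) = 1 := by
  have h0 : c * shearProfile (x 2) = 0 := congrFun hx 0
  have h1 : c * Real.sin (2 * π * x 2) = 0 := congrFun hx 1
  have h2 := (mul_eq_zero.1 h0).resolve_left hc
  have h3 := (mul_eq_zero.1 h1).resolve_left hc
  have h4 : Real.cos (4 * π * x 2) = 1 - 2 * Real.sin (2 * π * x 2) ^ 2 := by
    rw [Real.sin_sq, show 4 * π * x 2 = 2 * (2 * π * x 2) by ring, Real.cos_two_mul]; ring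
  rw [shearProfile, h4, h3] at h2
  linarith

theorem eventually_nonneg_shearField {c : ℝ} (hc : 0 < c) {x : Fin 3 → ℝ}
    (hx : Real.cos (2 * π * x 2) = 1) : ∀ᶠ y in 𝓝 x, 0 ≤ shearField c y 0 := by
  have hcont : Continuous fun y : Fin 3 → ℝ => Real.cos (2 * π * y 2) := by fun_prop
  have h : ∀ᶠ y in 𝓝 x, 0 < Real.cos (2 * π * y 2) :=
    hcont.continuousAt.eventually (lt_mem_nhds (by beta_reduce; rw [hx]; exact one_pos))
  filter_upwards [h] with y hy
  refine mul_nonneg hc.le ?_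
  rw [shearProfile, show 4 * π * y 2 = 2 * (2 * π * y 2) by ring, Real.cos_two_mul]
  nlinarith [Real.cos_le_one (2 * π * y 2)]

theorem exists_shearField_eq_zero (c : ℝ) : ∃ x, shearField c x = 0 :=
  ⟨0, by ext i; fin_cases i <;> simp [shearField, shearProfile]⟩

theorem sum_pd_pd_shearField_pos {c : ℝ} (hc : 0 < c) {x : Fin 3 → ℝ}
    (hx : Real.cos (2 * π * x 2) = 1) :
    (∀ j, pd j (fun y => shearField c y 0) x = 0) ∧
      0 < ∑ j, pd j (pd j fun y => shearField c y 0) x := by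
  have h1 : ∀ j, pd j (fun y => shearField c y 0) = fun x => if j = 2 then
      c * (4 * π * Real.sin (4 * π * x 2) - 2 * π * Real.sin (2 * π * x 2)) else 0 := fun j =>
    funext fun x => pd_comp_eval 2 j ((hasDerivAt_shearProfile (x 2)).const_mul c)
  have hs : Real.sin (2 * π * x 2) = 0 := by
    have := Real.sin_sq_add_cos_sq (2 * π * x 2)
    rw [hx] at this
    exact pow_eq_zero_iff two_ne_zero |>.1 (by linarith)
  have hs4 : Real.sin (4 * π * x 2) = 0 := by
    rw [show 4 * π * x 2 = 2 * (2 * π * x 2) by ring, Real.sin_two_mul, hs]; simp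
  have hc4 : Real.cos (4 * π * x 2) = 1 := by
    rw [show 4 * π * x 2 = 2 * (2 * π * x 2) by ring, Real.cos_two_mul, hx]; norm_num
  refine ⟨fun j => by simp [h1, hs, hs4], ?_⟩
  have h2 : ∀ j, pd j (pd j fun y => shearField c y 0) x = if j = 2 then
      c * (16 * π ^ 2 * Real.cos (4 * π * x 2) - 4 * π ^ 2 * Real.cos (2 * π * x 2)) else 0 := by
    intro j
    rw [h1]
    by_cases hj : j = 2
    · simp only [hj, if_true]
      exact (pd_comp_eval 2 2 ((hasDerivAt_deriv_shearProfile (x 2)).const_mul c)).trans (by simp)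
    · simp [hj, pd]
  rw [Finset.sum_congr rfl fun j _ => h2 j, Finset.sum_ite_eq' Finset.univ, hx, hc4]
  simp only [Finset.mem_univ, if_true]
  have := Real.pi_pos
  have : c * (16 * π ^ 2 * 1 - 4 * π ^ 2 * 1) = 12 * c * π ^ 2 := by ring
  rw [this]
  positivity

end Shear

/-- instantaneous reconnection in 3D, Theorem 1.4 of the paper for `d = 3`.
For any `ν, η, M > 0` and any smooth zero-average divergence-free initial velocity `u₀` there
are a smooth zero-average divergence-free `b₀` with `‖b₀‖_{L²} = M`, a time `T₀ > 0` and a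
smooth solution of the MHD system on `[0, T₀)` with initial datum `(u₀, b₀)` whose magnetic
lines at any time `t ∈ (0, T₀)` are not topologically equivalent to those at time `0`. -/
theorem instantaneous_reconnection_3d (ν η M : ℝ)
    (hν : 0 < ν) (hη : 0 < η) (hM : 0 < M)
    (u₀ : (Fin 3 → ℝ) → Fin 3 → ℝ)
    (hu₀ : ContDiff ℝ (⊤ : ℕ∞) u₀) (hu₀p : Prdc 1 u₀)
    (hu₀div : ∀ x, divg u₀ x = 0) (hu₀avg : ZeroAvg 1 u₀) :
    ∃ b₀ : (Fin 3 → ℝ) → Fin 3 → ℝ,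
      ContDiff ℝ (⊤ : ℕ∞) b₀ ∧ Prdc 1 b₀ ∧ (∀ x, divg b₀ x = 0) ∧
      ZeroAvg 1 b₀ ∧ L2norm 1 b₀ = M ∧
      ∃ T₀ : ℝ, 0 < T₀ ∧
        ∃ (u b : ℝ → (Fin 3 → ℝ) → Fin 3 → ℝ) (P : ℝ → (Fin 3 → ℝ) → ℝ),
          IsMHD 3 1 ν η (Set.Ico 0 T₀) u b P ∧ u 0 = u₀ ∧ b 0 = b₀ ∧
          ∀ t : ℝ, 0 < t → t < T₀ → ¬ MagLinesEquiv 3 1 (b 0) (b t) := by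
  have hc : 0 < M * √(2 / 3) := by positivity
  obtain ⟨T, hT, u, b, P, hmhd, hu0, hb0, β, hβ, hd, hβ0⟩ := exists_mhd_solution hν hη hu₀ hu₀p
    hu₀div (contDiff_shearField _) (prdc_shearField _) (divg_shearField (M * √(2 / 3)))
  have hzero : ∀ x, b 0 x = 0 → ∃ i, 0 < β 0 x i ∧ ∀ᶠ y in 𝓝 x, 0 ≤ b 0 y i := by
    intro x hx
    rw [hb0] at hx ⊢
    have hcos := cos_eq_one_of_shearField_eq_zero hc.ne' hx
    obtain ⟨hpd, hlap⟩ := sum_pd_pd_shearField_pos hc hcos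
    refine ⟨0, ?_, eventually_nonneg_shearField hc hcos⟩
    rw [hβ0, hx]
    simpa only [hpd, mul_zero, Finset.sum_const_zero, sub_zero, Pi.zero_apply, zero_mul, add_zero]
      using mul_pos hη hlap
  have hev := eventually_forall_ne_zero hT hmhd.periodic_b hmhd.smooth_b.continuousOn hβ hd hzero
  obtain ⟨ε, hε, hne⟩ := Metric.eventually_nhds_iff.1 hev
  refine ⟨shearField (M * √(2 / 3)), contDiff_shearField _, prdc_shearField _, divg_shearField _,
    zeroAvg_shearField _, l2norm_shearField hM.le, min T ε, lt_min hT hε, u, b, P,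
    hmhd.mono (Ico_subset_Ico_right (min_le_left _ _)), hu0, hb0, fun t ht0 htT hequiv => ?_⟩
  obtain ⟨x, hx⟩ := hequiv.exists_eq_zero (hb0 ▸ exists_shearField_eq_zero _)
  refine hne ?_ ht0 x hx
  rw [Real.dist_eq, sub_zero, abs_of_pos ht0]
  exact htT.trans_le (min_le_right _ _)

end
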